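/- arXiv:1909.12628 — 3 statements merged into one kernel-verified Lean document; each statement's English description precedes it below -/
import Mathlib

section
/- If K ⊆ V(G) spans an infinite complete subgraph of G, then the set τ = {(A,B) : (A,B) a finite-order separation of G with K ⊆ B} is a closed subset of the space of finite-order oriented separations of G, and τ is the end tangle of the unique end containing all rays within K. -/
open Set

universe u

/-- A separation of a graph `G`: a pair of vertex sets covering `V` with no
edge between `A \ B` and `B \ A`. -/
structure Separation {V : Type u} (G : SimpleGraph V) where
  A : Set V
  B : Set V
  union_eq : A ∪ B = Set.univ
  no_edge : ∀ a ∈ A \ B, ∀ b ∈ B \ A, ¬ G.Adj a b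

/-- The oriented separations of finite order. -/
abbrev FinSep {V : Type u} (G : SimpleGraph V) := {s : Separation G // (s.A ∩ s.B).Finite}

/-- The separation topology: basic open sets prescribe the restriction of a
separation to a finite vertex set `Z`. -/
instance sepTop {V : Type u} (G : SimpleGraph V) : TopologicalSpace (FinSep G) :=
  TopologicalSpace.generateFrom
    {O | ∃ Z AZ BZ : Set V, Z.Finite ∧
      O = {s : FinSep G | s.1.A ∩ Z = AZ ∧ s.1.B ∩ Z = BZ}}

/-- The reverse orientation of a finite-order separation. -/
def FinSep.rev {V : Type u} {G : SimpleGraph V} (s : FinSep G) : FinSep G :=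
  ⟨⟨s.1.B, s.1.A, by rw [Set.union_comm]; exact s.1.union_eq,
    fun a ha b hb h => s.1.no_edge b hb a ha h.symm⟩,
   by rw [Set.inter_comm]; exact s.2⟩

/-- A ray in a graph: an injective sequence of successively adjacent vertices. -/
structure GraphRay {V : Type u} (G : SimpleGraph V) where
  f : ℕ → V
  inj : Function.Injective f
  adj : ∀ n, G.Adj (f n) (f (n + 1))

/-- Two rays are equivalent if no finite vertex set separates them. -/
def RayEquiv {V : Type u} (G : SimpleGraph V) (R R' : GraphRay G) : Prop :=
  ∀ F : Set V, F.Finite →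
    ∃ (m n : ℕ) (w : G.Walk (R.f m) (R'.f n)), ∀ x ∈ w.support, x ∉ F

/-- An end of a graph: a (nonempty) equivalence class of rays. -/
structure GraphEnd {V : Type u} (G : SimpleGraph V) where
  rays : Set (GraphRay G)
  nonempty : rays.Nonempty
  mem_iff : ∀ R ∈ rays, ∀ R', R' ∈ rays ↔ RayEquiv G R R'

/-- A ray has a tail in `B`. -/
def HasTailIn {V : Type u} {G : SimpleGraph V} (R : GraphRay G) (B : Set V) : Prop :=
  ∃ N, ∀ n ≥ N, R.f n ∈ B

/-- The end tangle induced by the end `ω`: all finite-order separations `(A,B)`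
such that every ray of `ω` has a tail in `B`. -/
def endTangle {V : Type u} {G : SimpleGraph V} (ω : GraphEnd G) : Set (FinSep G) :=
  {s | ∀ R ∈ ω.rays, HasTailIn R s.1.B}

/-- `v` dominates the end `ω`: `v` sends infinitely many paths to a ray of `ω`
which pairwise meet only in `v`. -/
def Dominates {V : Type u} (G : SimpleGraph V) (v : V) (ω : GraphEnd G) : Prop :=
  ∃ R ∈ ω.rays, ∃ p : ℕ → (n : ℕ) × G.Walk v (R.f n),
    (∀ i, (p i).2.IsPath) ∧ (Function.Injective fun i => (p i).1) ∧
    ∀ i j, i ≠ j → ∀ x, x ∈ (p i).2.support → x ∈ (p j).2.support → x = v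

/-- The end `ω` has (vertex) degree at least `m`: there are `m` pairwise
disjoint rays belonging to `ω`. -/
def DegGE {V : Type u} (G : SimpleGraph V) (ω : GraphEnd G) (m : ℕ) : Prop :=
  ∃ R : Fin m → GraphRay G, (∀ i, R i ∈ ω.rays) ∧
    ∀ i j, i ≠ j → Disjoint (Set.range (R i).f) (Set.range (R j).f)

/-- At least `n` vertices dominate `ω`. -/
def DomGE {V : Type u} (G : SimpleGraph V) (ω : GraphEnd G) (n : ℕ) : Prop :=
  ∃ D : Finset V, D.card = n ∧ ∀ v ∈ D, Dominates G v ω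

/-- `deg(ω) + dom(ω) ≥ k`. -/
def DegDomGE {V : Type u} (G : SimpleGraph V) (ω : GraphEnd G) (k : ℕ) : Prop :=
  ∃ m n, m + n = k ∧ DegGE G ω m ∧ DomGE G ω n

/-- `T` separates `X` from the end `ω`: every ray of `ω` meeting `X` meets `T`. -/
def SeparatesFromEnd {V : Type u} (G : SimpleGraph V) (X T : Set V) (ω : GraphEnd G) : Prop :=
  ∀ R ∈ ω.rays, (∃ n, R.f n ∈ X) → ∃ n, R.f n ∈ T

/-- `K` is `(<ℵ₀)`-inseparable (apart from the infiniteness requirement): no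
finite-order separation separates two of its vertices. -/
def FinInseparable {V : Type u} (G : SimpleGraph V) (K : Set V) : Prop :=
  ∀ s : FinSep G, ∀ x ∈ K, ∀ y ∈ K, ¬(x ∈ s.1.A \ s.1.B ∧ y ∈ s.1.B \ s.1.A)

/-- An `ℵ₀`-block: a maximal infinite set of vertices no two of which can be
separated by a finite-order separation. -/
def Aleph0Block {V : Type u} (G : SimpleGraph V) (K : Set V) : Prop :=
  K.Infinite ∧ FinInseparable G K ∧
    ∀ K' : Set V, K ⊆ K' → K'.Infinite → FinInseparable G K' → K' = K

/-- `u` and `v` are joined by a walk avoiding `F`. -/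
def JoinedAvoiding {V : Type u} (G : SimpleGraph V) (F : Set V) (u v : V) : Prop :=
  ∃ w : G.Walk u v, ∀ x ∈ w.support, x ∉ F

namespace JoinedAvoiding

variable {V : Type u} {G : SimpleGraph V} {F : Set V} {u v w : V}

theorem refl (h : u ∉ F) : JoinedAvoiding G F u u :=
  ⟨.nil, by simpa using h⟩

theorem symm (h : JoinedAvoiding G F u v) : JoinedAvoiding G F v u := by
  obtain ⟨p, hp⟩ := h
  exact ⟨p.reverse, by simpa using hp⟩

theorem trans (h : JoinedAvoiding G F u v) (h' : JoinedAvoiding G F v w) :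
    JoinedAvoiding G F u w := by
  obtain ⟨p, hp⟩ := h
  obtain ⟨q, hq⟩ := h'
  refine ⟨p.append q, fun x hx => ?_⟩
  rcases (SimpleGraph.Walk.mem_support_append_iff p q).1 hx with hx | hx
  exacts [hp x hx, hq x hx]

theorem of_adj (h : G.Adj u v) (hu : u ∉ F) (hv : v ∉ F) : JoinedAvoiding G F u v :=
  ⟨h.toWalk, by simp [hu, hv]⟩

theorem mono {F' : Set V} (hF : F ⊆ F') (h : JoinedAvoiding G F' u v) :
    JoinedAvoiding G F u v := by
  obtain ⟨p, hp⟩ := h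
  exact ⟨p, fun x hx hxF => hp x hx (hF hxF)⟩

theorem left_notMem (h : JoinedAvoiding G F u v) : u ∉ F := by
  obtain ⟨p, hp⟩ := h
  exact hp u p.start_mem_support

theorem right_notMem (h : JoinedAvoiding G F u v) : v ∉ F :=
  h.symm.left_notMem

/-- A walk avoiding the separator of a separation stays on its side. -/
theorem mem_B {s : Separation G} (h : JoinedAvoiding G (s.A ∩ s.B) u v) (hu : u ∈ s.B) :
    v ∈ s.B := by
  obtain ⟨p, hp⟩ := h
  induction p with
  | nil => exact hu
  | @cons a b c hab q ih =>
    refine ih ?_ fun x hx => hp x (by simp [hx])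
    by_contra hb
    have hbA : b ∈ s.A := (s.union_eq.symm ▸ mem_univ b : b ∈ s.A ∪ s.B).resolve_right hb
    exact s.no_edge b ⟨hbA, hb⟩ a ⟨hu, fun ha => hp a (by simp) ⟨ha, hu⟩⟩ hab.symm

end JoinedAvoiding

theorem GraphRay.exists_tail_notMem {V : Type u} {G : SimpleGraph V} (R : GraphRay G)
    {F : Set V} (hF : F.Finite) : ∃ N, ∀ n ≥ N, R.f n ∉ F := by
  obtain ⟨N, hN⟩ := (hF.preimage R.inj.injOn).bddAbove
  exact ⟨N + 1, fun n hn hnF => absurd (hN hnF) (by omega)⟩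

theorem GraphRay.joinedAvoiding_tail {V : Type u} {G : SimpleGraph V} (R : GraphRay G)
    {F : Set V} {N : ℕ} (hN : ∀ n ≥ N, R.f n ∉ F) {n : ℕ} (hn : N ≤ n) :
    JoinedAvoiding G F (R.f N) (R.f n) := by
  induction n, hn using Nat.le_induction with
  | base => exact .refl (hN N le_rfl)
  | succ n hn ih => exact ih.trans (.of_adj (R.adj n) (hN n hn) (hN _ (by omega)))

/-- Equivalent rays have tails joined outside any given finite set. -/
theorem RayEquiv.exists_tails_joined {V : Type u} {G : SimpleGraph V} {R R' : GraphRay G}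
    (h : RayEquiv G R R') {F : Set V} (hF : F.Finite) :
    ∃ N, ∀ m ≥ N, ∀ n ≥ N, JoinedAvoiding G F (R.f m) (R'.f n) := by
  obtain ⟨M, hM⟩ := R.exists_tail_notMem hF
  obtain ⟨M', hM'⟩ := R'.exists_tail_notMem hF
  obtain ⟨m, n, hmn⟩ := h (F ∪ (R.f '' Iio M ∪ R'.f '' Iio M'))
    (hF.union (((finite_Iio M).image _).union ((finite_Iio M').image _)))
  replace hmn : JoinedAvoiding G _ _ _ := hmn
  have hm : M ≤ m := not_lt.1 fun hlt =>
    hmn.left_notMem (.inr (.inl (mem_image_of_mem _ hlt)))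
  have hn : M' ≤ n := not_lt.1 fun hlt =>
    hmn.right_notMem (.inr (.inr (mem_image_of_mem _ hlt)))
  have key := ((R.joinedAvoiding_tail hM hm).trans (hmn.mono subset_union_left)).trans
    (R'.joinedAvoiding_tail hM' hn).symm
  refine ⟨max M M', fun i hi j hj => ?_⟩
  exact ((R.joinedAvoiding_tail hM (le_of_max_le_left hi)).symm.trans key).trans
    (R'.joinedAvoiding_tail hM' (le_of_max_le_right hj))

theorem RayEquiv.symm {V : Type u} {G : SimpleGraph V} {R R' : GraphRay G}
    (h : RayEquiv G R R') : RayEquiv G R' R := by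
  intro F hF
  obtain ⟨m, n, hmn⟩ := h F hF
  exact ⟨n, m, JoinedAvoiding.symm hmn⟩

theorem RayEquiv.trans {V : Type u} {G : SimpleGraph V} {R R' R'' : GraphRay G}
    (h : RayEquiv G R R') (h' : RayEquiv G R' R'') : RayEquiv G R R'' := by
  intro F hF
  obtain ⟨N, hN⟩ := h.exists_tails_joined hF
  obtain ⟨N', hN'⟩ := h'.exists_tails_joined hF
  exact ⟨N, N', (hN N le_rfl (max N N') (le_max_left _ _)).trans
    (hN' (max N N') (le_max_right _ _) N' le_rfl)⟩

theorem RayEquiv.refl {V : Type u} {G : SimpleGraph V} (R : GraphRay G) : RayEquiv G R R := by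
  intro F hF
  obtain ⟨N, hN⟩ := R.exists_tail_notMem hF
  exact ⟨N, N, JoinedAvoiding.refl (hN N le_rfl)⟩

/-- The end of a graph containing a given ray. -/
def GraphRay.toEnd {V : Type u} {G : SimpleGraph V} (R : GraphRay G) : GraphEnd G where
  rays := {R' | RayEquiv G R R'}
  nonempty := ⟨R, .refl R⟩
  mem_iff _ h _ := ⟨fun h' => RayEquiv.trans (RayEquiv.symm h) h', fun h' => RayEquiv.trans h h'⟩

theorem GraphRay.eq_toEnd {V : Type u} {G : SimpleGraph V} {R : GraphRay G} {ω : GraphEnd G}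
    (h : R ∈ ω.rays) : ω = R.toEnd := by
  obtain ⟨rays, hne, hmem⟩ := ω
  have : rays = {R' | RayEquiv G R R'} := Set.ext (hmem R h)
  subst this
  rfl

theorem rayEquiv_of_range_subset_clique {V : Type u} {G : SimpleGraph V} {K : Set V}
    (hcomp : ∀ x ∈ K, ∀ y ∈ K, x ≠ y → G.Adj x y) {R R' : GraphRay G}
    (hR : range R.f ⊆ K) (hR' : range R'.f ⊆ K) : RayEquiv G R R' := by
  intro F hF
  obtain ⟨m, hm⟩ := R.exists_tail_notMem hF
  obtain ⟨n, hn⟩ := R'.exists_tail_notMem hF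
  refine ⟨m, n, ?_⟩
  change JoinedAvoiding G F (R.f m) (R'.f n)
  by_cases h : R.f m = R'.f n
  · rw [← h]
    exact .refl (hm m le_rfl)
  · exact .of_adj (hcomp _ (hR (mem_range_self m)) _ (hR' (mem_range_self n)) h)
      (hm m le_rfl) (hn n le_rfl)

theorem exists_ray_of_infinite_clique {V : Type u} {G : SimpleGraph V} {K : Set V}
    (hK : K.Infinite) (hcomp : ∀ x ∈ K, ∀ y ∈ K, x ≠ y → G.Adj x y) :
    ∃ R : GraphRay G, range R.f ⊆ K := by
  let e := hK.natEmbedding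
  have he : Function.Injective fun n => (e n : V) := Subtype.val_injective.comp e.injective
  refine ⟨⟨fun n => e n, he, fun n => hcomp _ (e n).2 _ (e (n + 1)).2 fun h => ?_⟩, ?_⟩
  · exact absurd (he h) (by omega)
  · rintro _ ⟨n, rfl⟩
    exact (e n).2

theorem isOpen_setOf_notMem_B {V : Type u} (G : SimpleGraph V) (x : V) :
    IsOpen {s : FinSep G | x ∉ s.1.B} := by
  apply TopologicalSpace.isOpen_generateFrom_of_mem
  refine ⟨{x}, {x}, ∅, finite_singleton x, ?_⟩
  ext s
  have hx : x ∈ s.1.A ∪ s.1.B := s.1.union_eq.symm ▸ mem_univ x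
  simp only [mem_ofPred_eq, inter_eq_right, singleton_subset_iff, inter_singleton_eq_empty]
  exact ⟨fun h => ⟨hx.resolve_right h, h⟩, And.right⟩

theorem isClosed_setOf_subset_B {V : Type u} (G : SimpleGraph V) (K : Set V) :
    IsClosed {s : FinSep G | K ⊆ s.1.B} := by
  have : {s : FinSep G | K ⊆ s.1.B} = ⋂ x ∈ K, {s : FinSep G | x ∉ s.1.B}ᶜ := by
    ext s
    simp [subset_def]
  rw [this]
  exact isClosed_biInter fun x _ => (isOpen_setOf_notMem_B G x).isClosed_compl

theorem endTangle_toEnd_of_clique {V : Type u} {G : SimpleGraph V} {K : Set V}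
    (hcomp : ∀ x ∈ K, ∀ y ∈ K, x ≠ y → G.Adj x y) {R : GraphRay G} (hR : range R.f ⊆ K) :
    endTangle R.toEnd = {s : FinSep G | K ⊆ s.1.B} := by
  ext s
  refine ⟨fun h x hx => ?_, fun h R' hR' => ?_⟩
  · by_contra hxB
    have hxA : x ∈ s.1.A :=
      (s.1.union_eq.symm ▸ mem_univ x : x ∈ s.1.A ∪ s.1.B).resolve_right hxB
    obtain ⟨N, hN⟩ := h R (.refl R)
    obtain ⟨M, hM⟩ := R.exists_tail_notMem s.2
    have hB := hN (max N M) (le_max_left _ _)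
    have hA : R.f (max N M) ∉ s.1.A := fun hA => hM _ (le_max_right _ _) ⟨hA, hB⟩
    exact s.1.no_edge x ⟨hxA, hxB⟩ _ ⟨hB, hA⟩
      (hcomp x hx _ (hR (mem_range_self _)) fun heq => hxB (heq ▸ hB))
  · obtain ⟨N, hN⟩ := RayEquiv.exists_tails_joined hR' s.2
    exact ⟨N, fun n hn => (hN N le_rfl n hn).mem_B (h (hR (mem_range_self N)))⟩

/-- if `K` spans an infinite complete subgraph then
`{(A,B) : K ⊆ B}` is closed, and it is the end tangle of the unique end
containing all rays within `K`. -/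
theorem complete_subgraph_closed {V : Type u} [Infinite V] (G : SimpleGraph V)
    (K : Set V) (hK : K.Infinite) (hcomp : ∀ x ∈ K, ∀ y ∈ K, x ≠ y → G.Adj x y) :
    IsClosed {s : FinSep G | K ⊆ s.1.B} ∧
    (∃! ω : GraphEnd G, ∀ R : GraphRay G, Set.range R.f ⊆ K → R ∈ ω.rays) ∧
    ∀ ω : GraphEnd G, (∀ R : GraphRay G, Set.range R.f ⊆ K → R ∈ ω.rays) →
      endTangle ω = {s : FinSep G | K ⊆ s.1.B} := by
  obtain ⟨R, hR⟩ := exists_ray_of_infinite_clique hK hcomp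
  refine ⟨isClosed_setOf_subset_B G K, ⟨R.toEnd, ?_, ?_⟩, fun ω hω => ?_⟩
  · exact fun R' hR' => rayEquiv_of_range_subset_clique hcomp hR hR'
  · exact fun ω hω => GraphRay.eq_toEnd (hω R hR)
  · rw [GraphRay.eq_toEnd (hω R hR)]
    exact endTangle_toEnd_of_clique hcomp hR
end

section
/- Let ω be an undominated end of a graph G and X ⊆ V a finite vertex set. Then the largest size of a family of pairwise disjoint ω-rays starting in X equals the smallest size of a set T ⊆ V separating X from ω. -/
open Set

universe u

/-- A Menger-type linking lemma in cut form: if every vertex set `S ⊆ Y \ B` has at least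
`|A ∩ S|` boundary vertices in `Y \ A`, then some injection of `Y \ B` into `Y \ A` moves only
finitely many vertices, each to a neighbour. Its orbits link `A` to `B` disjointly. -/
theorem exists_linking {V : Type u} (G : SimpleGraph V) (Y B : Set V) (A : Finset V)
    (h : ∀ S ⊆ Y \ B, ∀ Z : Finset V,
      (∀ u ∈ Y, u ∉ S → u ∉ A → (∃ v ∈ S, G.Adj v u) → u ∈ Z) →
        (↑A ∩ S).ncard ≤ Z.card) :
    ∃ σ : V → V, InjOn σ (Y \ B) ∧ (∀ v ∈ Y \ B, σ v ∈ Y \ ↑A) ∧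
      (∀ v ∈ Y \ B, σ v ≠ v → G.Adj v (σ v)) ∧ {v ∈ Y \ B | σ v ≠ v}.Finite := by
  classical
  by_cases hW : ∃ W : Finset V, A ⊆ W ∧ ∀ s ⊆ W, (∀ v ∈ s, v ∈ Y \ B) →
      s.card ≤ (W.filter fun u => u ∈ Y ∧ u ∉ A ∧ ∃ v ∈ s, v = u ∨ G.Adj v u).card
  · obtain ⟨W, hAW, hW⟩ := hW
    obtain ⟨g, hginj, hg⟩ := (Finset.all_card_le_biUnion_card_iff_exists_injective
      (fun v : {v // v ∈ W ∧ v ∈ Y \ B} =>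
        W.filter fun u => u ∈ Y ∧ u ∉ A ∧ (v.1 = u ∨ G.Adj v u))).1 (by
      intro s
      have := hW (s.map (Function.Embedding.subtype _)) (by
        intro v hv
        obtain ⟨w, -, rfl⟩ := Finset.mem_map.1 hv
        exact w.2.1) (by
        intro v hv
        obtain ⟨w, -, rfl⟩ := Finset.mem_map.1 hv
        exact w.2.2)
      rw [Finset.card_map] at this
      refine this.trans (Finset.card_le_card ?_)
      intro u hu
      simp only [Finset.mem_filter, Finset.mem_map, Finset.mem_biUnion] at hu ⊢
      obtain ⟨huW, huY, huA, v, ⟨w, hw, rfl⟩, hv⟩ := hu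
      exact ⟨w, hw, huW, huY, huA, hv⟩)
    simp only [Finset.mem_filter] at hg
    refine ⟨fun v => if hv : v ∈ W ∧ v ∈ Y \ B then g ⟨v, hv⟩ else v, ?_, ?_, ?_, ?_⟩
    · intro v hv w hw hvw
      by_cases hv' : v ∈ W <;> by_cases hw' : w ∈ W
      · simp only [hv', hv, hw', hw, and_self, dite_true] at hvw
        exact congrArg Subtype.val (hginj hvw)
      · simp only [hv', hv, hw', hw, and_self, dite_true, false_and, dite_false] at hvw
        exact absurd (hvw ▸ (hg ⟨v, hv', hv⟩).1) hw'
      · simp only [hv', hv, hw', hw, and_self, dite_true, false_and, dite_false] at hvw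
        exact absurd (hvw ▸ (hg ⟨w, hw', hw⟩).1) hv'
      · simpa only [hv', hw', false_and, dite_false] using hvw
    · intro v hv
      by_cases hv' : v ∈ W
      · simp only [hv', hv, and_self, dite_true]
        exact ⟨(hg ⟨v, hv', hv⟩).2.1, (hg ⟨v, hv', hv⟩).2.2.1⟩
      · simp only [hv', false_and, dite_false]
        exact ⟨hv.1, fun ha => hv' (hAW ha)⟩
    · intro v hv
      by_cases hv' : v ∈ W
      · simp only [hv', hv, and_self, dite_true]
        exact fun hne => (hg ⟨v, hv', hv⟩).2.2.2.resolve_left (Ne.symm hne)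
      · simp [hv']
    · refine W.finite_toSet.subset ?_
      rintro v ⟨-, hne⟩
      by_contra hv'
      exact hne (dif_neg fun h => hv' h.1)
  · exfalso
    push Not at hW
    choose s hsW hsY hs using fun W : Finset V => hW (W ∪ A) Finset.subset_union_right
    set U : Ultrafilter (Finset V) := Ultrafilter.of Filter.atTop
    have hU : ∀ v, ∀ᶠ W in (U : Filter (Finset V)), v ∈ W := fun v =>
      (Ultrafilter.of_le Filter.atTop) <| (Filter.eventually_ge_atTop {v}).mono
        fun W hW => hW (Finset.mem_singleton_self v)
    set S : Set V := {v | ∀ᶠ W in (U : Filter (Finset V)), v ∈ s W}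
    have hnS : ∀ v ∉ S, ∀ᶠ W in (U : Filter (Finset V)), v ∉ s W := fun v hv =>
      Ultrafilter.eventually_not.2 hv
    have hSY : S ⊆ Y \ B := fun v hv => by
      obtain ⟨W, hW⟩ := Filter.Eventually.exists hv
      exact hsY W v hW
    set D : Set V := {u | u ∈ Y ∧ u ∉ S ∧ u ∉ A ∧ ∃ v ∈ S, G.Adj v u}
    have hD : ∀ Z : Finset V, ↑Z ⊆ D → Z.card < (↑A ∩ S).ncard := by
      intro Z hZ
      have h1 : ∀ᶠ W in (U : Filter (Finset V)), ∀ a ∈ A, a ∈ S ↔ a ∈ s W := by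
        rw [Filter.eventually_all_finset]
        intro a _
        by_cases ha : a ∈ S
        · exact Filter.Eventually.mono ha fun W hW => by simp [ha, hW]
        · exact (hnS a ha).mono fun W hW => by simp [ha, hW]
      have h2 : ∀ᶠ W in (U : Filter (Finset V)), ∀ u ∈ Z,
          u ∈ W ∧ u ∉ s W ∧ ∃ v ∈ s W, G.Adj v u := by
        rw [Filter.eventually_all_finset]
        intro u hu
        obtain ⟨-, huS, -, v, hv, hvu⟩ := hZ hu
        filter_upwards [hU u, hnS u huS, hv] with W h1 h2 h3
        exact ⟨h1, h2, v, h3, hvu⟩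
      obtain ⟨W, h1, h2⟩ := (h1.and h2).exists
      have hcard : (↑A ∩ S).ncard = (s W ∩ A).card := by
        rw [← Set.ncard_coe_finset]
        congr 1
        ext a
        simp only [Set.mem_inter_iff, Finset.mem_coe, Finset.mem_inter]
        exact ⟨fun ha => ⟨(h1 a ha.1).1 ha.2, ha.1⟩, fun ha => ⟨ha.2, (h1 a ha.2).2 ha.1⟩⟩
      have hdisj : Disjoint (s W \ A) Z := Finset.disjoint_left.2 fun u hu huZ =>
        (h2 u huZ).2.1 (Finset.mem_sdiff.1 hu).1
      have hle : ((s W \ A) ∪ Z).card ≤ _ := Finset.card_le_card (t := (W ∪ A).filter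
          fun u => u ∈ Y ∧ u ∉ A ∧ ∃ v ∈ s W, v = u ∨ G.Adj v u) (by
        intro u hu
        rw [Finset.mem_filter]
        rcases Finset.mem_union.1 hu with hu | hu
        · rw [Finset.mem_sdiff] at hu
          exact ⟨hsW W hu.1, (hsY W u hu.1).1, hu.2, u, hu.1, Or.inl rfl⟩
        · obtain ⟨huW, -, v, hv, hvu⟩ := h2 u hu
          exact ⟨Finset.mem_union_left _ huW, (hZ hu).1, (hZ hu).2.2.1, v, hv, Or.inr hvu⟩)
      rw [Finset.card_union_of_disjoint hdisj] at hle
      have := Finset.card_sdiff_add_card_inter (s W) A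
      have := hs W
      omega
    have hDfin : D.Finite := by
      by_contra hinf
      obtain ⟨Z, hZ, hZc⟩ := Set.Infinite.exists_subset_card_eq hinf (↑A ∩ S).ncard
      exact (hD Z hZ).ne hZc
    refine (hD hDfin.toFinset (by simp)).not_ge (h S hSY _ ?_)
    intro u h1 h2 h3 h4
    exact hDfin.mem_toFinset.2 ⟨h1, h2, h3, h4⟩

/-- Orbits of an injection that start outside its range are pairwise disjoint. -/
theorem iterate_eq_iterate_of_injOn {V : Type u} {σ : V → V} {P A : Set V} (hinj : InjOn σ P)
    (hA : ∀ v ∈ P, σ v ∉ A) {a b : V} (ha : a ∈ A) (hb : b ∈ A) {i j : ℕ}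
    (hi : ∀ i' < i, σ^[i'] a ∈ P) (hj : ∀ j' < j, σ^[j'] b ∈ P)
    (h : σ^[i] a = σ^[j] b) : i = j ∧ a = b := by
  induction i generalizing j with
  | zero =>
    cases j with
    | zero => exact ⟨rfl, h⟩
    | succ j =>
      rw [Function.iterate_succ_apply'] at h
      exact absurd (h ▸ ha) (hA _ (hj j j.lt_succ_self))
  | succ i ih =>
    cases j with
    | zero =>
      rw [Function.iterate_succ_apply'] at h
      exact absurd (h ▸ hb) (hA _ (hi i i.lt_succ_self))
    | succ j =>
      rw [Function.iterate_succ_apply', Function.iterate_succ_apply'] at h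
      obtain ⟨rfl, hab⟩ := ih (fun i' h' => hi i' (h'.trans i.lt_succ_self))
        (fun j' h' => hj j' (h'.trans j.lt_succ_self))
        (hinj (hi i i.lt_succ_self) (hj j j.lt_succ_self) h)
      exact ⟨rfl, hab⟩

/-- The ray obtained by deleting the first `n` vertices. -/
def GraphRay.drop {V : Type u} {G : SimpleGraph V} (R : GraphRay G) (n : ℕ) : GraphRay G where
  f k := R.f (n + k)
  inj _ _ h := Nat.add_left_cancel (R.inj h)
  adj k := R.adj (n + k)

/-- The ray obtained by prepending a new vertex. -/
def GraphRay.cons {V : Type u} {G : SimpleGraph V} (R : GraphRay G) (v : V)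
    (hadj : G.Adj v (R.f 0)) (hv : ∀ n, R.f n ≠ v) : GraphRay G where
  f
    | 0 => v
    | n + 1 => R.f n
  inj := by
    rintro (_ | m) (_ | n) h
    · rfl
    · exact absurd h.symm (hv n)
    · exact absurd h (hv m)
    · exact congrArg _ (R.inj h)
  adj
    | 0 => hadj
    | n + 1 => R.adj n

theorem GraphRay.exists_ge_notMem {V : Type u} {G : SimpleGraph V} (R : GraphRay G) {F : Set V}
    (hF : F.Finite) (N : ℕ) : ∃ n ≥ N, R.f n ∉ F := by
  by_contra! h
  exact Set.infinite_of_injective_forall_mem (R.drop N).inj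
    (fun k => h (N + k) (Nat.le_add_right N k)) hF

/-- A ray that meets a finite set has a last vertex in it. -/
theorem GraphRay.exists_last_mem {V : Type u} {G : SimpleGraph V} (R : GraphRay G) {F : Set V}
    (hF : F.Finite) (h : ∃ n, R.f n ∈ F) : ∃ n, R.f n ∈ F ∧ ∀ m > n, R.f m ∉ F := by
  have hfin : {n | R.f n ∈ F}.Finite := hF.preimage R.inj.injOn
  obtain ⟨n, hn⟩ := hfin.exists_maximal h
  exact ⟨n, hn.1, fun m hm hmF => hm.not_ge (hn.2 hmF hm.le)⟩

theorem GraphRay.exists_walk {V : Type u} {G : SimpleGraph V} (R : GraphRay G) (m : ℕ) :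
    ∃ w : G.Walk (R.f 0) (R.f m), ∀ x ∈ w.support, ∃ k, R.f k = x := by
  induction m with
  | zero => exact ⟨.nil, by simp⟩
  | succ m ih =>
    obtain ⟨w, hw⟩ := ih
    refine ⟨w.concat (R.adj m), fun x hx => ?_⟩
    rw [SimpleGraph.Walk.support_concat, List.mem_append,
      List.mem_singleton] at hx
    exact hx.elim (hw x) fun h => ⟨m + 1, h.symm⟩

theorem GraphEnd.mem_of_shift_eq {V : Type u} {G : SimpleGraph V} (ω : GraphEnd G)
    {R R' : GraphRay G} (hR : R ∈ ω.rays) (a b : ℕ) (h : ∀ n, R.f (a + n) = R'.f (b + n)) :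
    R' ∈ ω.rays := by
  refine (ω.mem_iff R hR R').2 fun F hF => ?_
  obtain ⟨m, hm, hmF⟩ := R.exists_ge_notMem hF a
  obtain ⟨k, rfl⟩ := Nat.exists_eq_add_of_le hm
  refine ⟨a + k, b + k, SimpleGraph.Walk.nil.copy rfl (h k), fun x hx => ?_⟩
  simp only [SimpleGraph.Walk.support_copy, SimpleGraph.Walk.support_nil,
    List.mem_singleton] at hx
  exact hx ▸ hmF

theorem GraphEnd.drop_mem {V : Type u} {G : SimpleGraph V} (ω : GraphEnd G) {R : GraphRay G}
    (hR : R ∈ ω.rays) (n : ℕ) : R.drop n ∈ ω.rays :=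
  ω.mem_of_shift_eq hR n 0 fun k => by simp [GraphRay.drop]

/-- The vertices that are the origin of an `ω`-ray avoiding `T`. -/
def GraphEnd.beyond {V : Type u} {G : SimpleGraph V} (ω : GraphEnd G) (T : Set V) : Set V :=
  {v | ∃ R ∈ ω.rays, R.f 0 = v ∧ ∀ n, R.f n ∉ T}

section
variable {V : Type u} {G : SimpleGraph V} {ω : GraphEnd G}

theorem GraphEnd.notMem_of_mem_beyond {T : Set V} {v : V} (hv : v ∈ ω.beyond T) : v ∉ T := by
  obtain ⟨R, -, rfl, h⟩ := hv
  exact h 0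

theorem GraphEnd.mem_beyond {T : Set V} {R : GraphRay G} (hR : R ∈ ω.rays) {n : ℕ}
    (h : ∀ m ≥ n, R.f m ∉ T) : R.f n ∈ ω.beyond T :=
  ⟨R.drop n, ω.drop_mem hR n, rfl, fun k => h _ (Nat.le_add_right n k)⟩

theorem GraphEnd.mem_beyond_of_adj {T : Set V} {u v : V} (hv : v ∈ ω.beyond T)
    (huv : G.Adj u v) (hu : u ∉ T) : u ∈ ω.beyond T := by
  obtain ⟨R, hR, rfl, h⟩ := hv
  by_cases hun : ∃ n, R.f n = u
  · obtain ⟨n, rfl⟩ := hun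
    exact GraphEnd.mem_beyond hR fun m _ => h m
  · refine ⟨R.cons u huv fun n hn => hun ⟨n, hn⟩, ω.mem_of_shift_eq hR 0 1 fun n => ?_, rfl, ?_⟩
    · rw [zero_add, add_comm]; rfl
    · rintro (_ | n)
      · exact hu
      · exact h n

theorem SeparatesFromEnd.notMem_beyond {X T : Set V} (h : SeparatesFromEnd G X T ω) {v : V}
    (hv : v ∈ X) : v ∉ ω.beyond T := by
  rintro ⟨R, hR, rfl, hT⟩
  obtain ⟨n, hn⟩ := h R hR ⟨0, hv⟩
  exact hT n hn

theorem SeparatesFromEnd.exists_ge {X T : Set V} (h : SeparatesFromEnd G X T ω) {R : GraphRay G}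
    (hR : R ∈ ω.rays) {n : ℕ} (hn : R.f n ∈ X) : ∃ m ≥ n, R.f m ∈ T := by
  obtain ⟨k, hk⟩ := h _ (ω.drop_mem hR n) ⟨0, hn⟩
  exact ⟨n + k, Nat.le_add_right n k, hk⟩

theorem SeparatesFromEnd.trans {X T Z : Set V} (h : SeparatesFromEnd G X T ω)
    (h' : SeparatesFromEnd G T Z ω) : SeparatesFromEnd G X Z ω :=
  fun R hR hX => h' R hR (h R hR hX)

theorem SeparatesFromEnd.beyond_subset {X T : Set V} (h : SeparatesFromEnd G X T ω) :
    ω.beyond T ⊆ ω.beyond X := by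
  rintro v ⟨R, hR, rfl, hT⟩
  refine ⟨R, hR, rfl, fun n hn => ?_⟩
  obtain ⟨m, hm⟩ := h R hR ⟨n, hn⟩
  exact hT m hm

/-- Every finite vertex set has a finite separator from `ω` of minimum size. -/
theorem exists_min_separator (ω : GraphEnd G) (X : Finset V) :
    ∃ T : Finset V, SeparatesFromEnd G (X : Set V) T ω ∧
      ∀ Z : Finset V, SeparatesFromEnd G (X : Set V) Z ω → T.card ≤ Z.card := by
  classical
  have hex : ∃ k, ∃ T : Finset V, SeparatesFromEnd G (X : Set V) T ω ∧ T.card = k :=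
    ⟨_, X, fun _ _ h => h, rfl⟩
  obtain ⟨T, hT, hTk⟩ := Nat.find_spec hex
  exact ⟨T, hT, fun Z hZ => hTk ▸ Nat.find_min' hex ⟨Z, hZ, rfl⟩⟩

/-- A vertex not dominating `ω` can be finitely separated from it. -/
theorem exists_finite_separator_of_not_dominates {v : V} (hv : ¬ Dominates G v ω) :
    ∃ S : Finset V, v ∉ S ∧ ∀ R ∈ ω.rays, R.f 0 = v → ∃ n, R.f n ∈ S := by
  classical
  by_contra! h
  obtain ⟨R, hR⟩ := ω.nonempty
  refine hv ⟨R, hR, ?_⟩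
  have : Std.Symm fun p q : (n : ℕ) × G.Walk v (R.f n) =>
      p.1 ≠ q.1 ∧ ∀ x, x ∈ p.2.support → x ∈ q.2.support → x = v :=
    ⟨fun p q h => ⟨h.1.symm, fun x hq hp => h.2 x hp hq⟩⟩
  obtain ⟨p, hp, hpp⟩ := exists_seq_of_forall_finset_exists'
    (fun p : (n : ℕ) × G.Walk v (R.f n) => p.2.IsPath ∧ R.f p.1 ≠ v)
    (fun p q => p.1 ≠ q.1 ∧ ∀ x, x ∈ p.2.support → x ∈ q.2.support → x = v) (by
    intro s hs
    set F : Finset V := (s.biUnion fun p => p.2.support.toFinset).erase v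
    have hF : ∀ p ∈ s, ∀ x ∈ p.2.support, x ≠ v → x ∈ F := fun p hp x hx hxv =>
      Finset.mem_erase.2 ⟨hxv, Finset.mem_biUnion.2 ⟨p, hp, List.mem_toFinset.2 hx⟩⟩
    obtain ⟨R', hR', h0, hR'F⟩ := h F (Finset.notMem_erase _ _)
    obtain ⟨m, n, w, hw⟩ := (ω.mem_iff R' hR' R).1 hR (↑(insert v F)) (Finset.finite_toSet _)
    obtain ⟨w', hw'⟩ : ∃ w' : G.Walk (R'.f 0) (R'.f m), ∀ x ∈ w'.support, ∃ k, R'.f k = x :=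
      R'.exists_walk m
    let q : G.Walk v (R.f n) := ((w'.append w).copy h0 rfl).bypass
    have hq : ∀ x ∈ q.support, x ∉ F := by
      intro x hx
      have := SimpleGraph.Walk.support_bypass_subset_support _ hx
      rw [SimpleGraph.Walk.support_copy, SimpleGraph.Walk.mem_support_append_iff] at this
      rcases this with hx | hx
      · obtain ⟨k, rfl⟩ := hw' x hx
        exact hR'F k
      · exact fun hxF => hw x hx (Finset.mem_coe.2 (Finset.mem_insert_of_mem hxF))
    have hnv : R.f n ≠ v := fun hn => hw _ w.end_mem_support (by simp [hn])
    refine ⟨⟨n, q⟩, ⟨SimpleGraph.Walk.bypass_isPath _, hnv⟩, fun p hp => ⟨?_, ?_⟩⟩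
    · rintro rfl
      exact hq _ q.end_mem_support (hF p hp _ p.2.end_mem_support hnv)
    · intro x hxp hxq
      by_contra hxv
      exact hq x hxq (hF p hp x hxp hxv))
  refine ⟨p, fun i => (hp i).1, fun i j hij => ?_, fun i j hij => (hpp hij).2⟩
  by_contra hne
  exact (hpp hne).1 hij

theorem exists_finite_separator_subset_beyond (hundom : ∀ v : V, ¬ Dominates G v ω)
    (T : Finset V) :
    ∃ S : Finset V, (S : Set V) ⊆ ω.beyond T ∧ SeparatesFromEnd G (T : Set V) S ω := by
  classical
  choose S hvS hS using fun v => exists_finite_separator_of_not_dominates (hundom v)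
  refine ⟨(T.biUnion S).filter (· ∈ ω.beyond T), fun v hv => (Finset.mem_filter.1 hv).2, ?_⟩
  intro R hR hRT
  obtain ⟨n, hn, hlast⟩ := R.exists_last_mem T.finite_toSet hRT
  obtain ⟨k, hk⟩ := hS _ _ (ω.drop_mem hR n) rfl
  have hk0 : k ≠ 0 := by
    rintro rfl
    exact hvS _ hk
  exact ⟨n + k, Finset.mem_filter.2 ⟨Finset.mem_biUnion.2 ⟨_, hn, hk⟩,
    GraphEnd.mem_beyond hR fun m hm => hlast m (by omega)⟩⟩

/-- `T` is a smallest separator of itself from `ω`. -/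
def GraphEnd.IsTight (ω : GraphEnd G) (T : Finset V) : Prop :=
  ∀ Z : Finset V, SeparatesFromEnd G (T : Set V) Z ω → T.card ≤ Z.card

theorem exists_isTight_separator_beyond (hundom : ∀ v : V, ¬ Dominates G v ω) (T : Finset V) :
    ∃ T' : Finset V, (T' : Set V) ⊆ ω.beyond T ∧ SeparatesFromEnd G (T : Set V) T' ω ∧
      ω.IsTight T' := by
  classical
  obtain ⟨S, hST, hS⟩ := exists_finite_separator_subset_beyond hundom T
  obtain ⟨T', hT', hmin⟩ := exists_min_separator ω S
  have hsep : SeparatesFromEnd G (S : Set V) (T'.filter (· ∈ ω.beyond T)) ω := by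
    intro R hR ⟨n, hn⟩
    obtain ⟨j, hj, k, hk⟩ : ∃ j, (∀ m ≥ j, R.f m ∉ (T : Set V)) ∧ ∃ k ≥ j, R.f k ∈ S := by
      by_cases hRT : ∃ n, R.f n ∈ (T : Set V)
      · obtain ⟨j, hj, hlast⟩ := R.exists_last_mem T.finite_toSet hRT
        obtain ⟨k, hk, hkS⟩ := hS.exists_ge hR hj
        have : k ≠ j := by
          rintro rfl
          exact GraphEnd.notMem_of_mem_beyond (hST hkS) hj
        exact ⟨j + 1, fun m hm => hlast m hm, k, by omega, hkS⟩
      · push Not at hRT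
        exact ⟨0, fun m _ => hRT m, n, n.zero_le, hn⟩
    obtain ⟨m, hm, hmT⟩ := hT'.exists_ge hR hk.2
    exact ⟨m, Finset.mem_filter.2 ⟨hmT, GraphEnd.mem_beyond hR fun i hi => hj i (by omega)⟩⟩
  refine ⟨T'.filter (· ∈ ω.beyond T), fun v hv => (Finset.mem_filter.1 hv).2, hS.trans ?_,
    fun Z hZ => ?_⟩
  · exact hsep
  · exact (Finset.card_filter_le _ _).trans (hmin Z (hsep.trans hZ))

/-- A tight set is linked to any separator of it from `ω`, within the part of the graph
between the two. -/
theorem GraphEnd.IsTight.exists_linking {T T' : Finset V} (hT : ω.IsTight T)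
    (hsep : SeparatesFromEnd G (T : Set V) T' ω) :
    ∃ σ : V → V, InjOn σ (((↑T ∪ ω.beyond T) \ ω.beyond T') \ ↑T') ∧
      (∀ v ∈ ((↑T ∪ ω.beyond T) \ ω.beyond T') \ ↑T', σ v ∈ ω.beyond T \ ω.beyond T') ∧
      (∀ v ∈ ((↑T ∪ ω.beyond T) \ ω.beyond T') \ ↑T', σ v ≠ v → G.Adj v (σ v)) ∧
      {v ∈ ((↑T ∪ ω.beyond T) \ ω.beyond T') \ ↑T' | σ v ≠ v}.Finite := by
  classical
  obtain ⟨σ, h1, h2, h3, h4⟩ := _root_.exists_linking G ((↑T ∪ ω.beyond T) \ ω.beyond T') ↑T' T (by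
    intro S hS Z hZ
    have hcut : SeparatesFromEnd G (T : Set V) ↑((T.filter (· ∉ S)) ∪ Z) ω := by
      intro R hR hRT
      obtain ⟨n, hn, hlast⟩ := R.exists_last_mem T.finite_toSet hRT
      by_cases hnS : R.f n ∈ S
      swap
      · exact ⟨n, by simpa using Or.inl ⟨hn, hnS⟩⟩
      obtain ⟨k, hk, hkT'⟩ := hsep.exists_ge hR hn
      have hex : ∃ i, R.f (n + i) ∉ S :=
        ⟨k - n, fun h => (hS h).2 (by rwa [Nat.add_sub_cancel' hk])⟩
      obtain ⟨i, hi⟩ : ∃ i, R.f (n + i) ∈ S ∧ R.f (n + (i + 1)) ∉ S := by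
        by_contra! hstep
        obtain ⟨i, hi⟩ := hex
        refine hi ?_
        clear hi
        induction i with
        | zero => exact hnS
        | succ i ih => exact hstep i ih
      refine ⟨n + (i + 1), Finset.mem_coe.2 (Finset.mem_union_right _ (hZ _ ⟨Or.inr ?_, ?_⟩ hi.2
        (hlast _ (by omega)) ⟨_, hi.1, R.adj _⟩))⟩
      · exact GraphEnd.mem_beyond hR fun m hm => hlast m (by omega)
      · exact fun h => (hS hi.1).1.2 (GraphEnd.mem_beyond_of_adj h (R.adj _) (hS hi.1).2)
    have hle := (hT _ hcut).trans (Finset.card_union_le _ _)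
    have hcard : (↑T ∩ S).ncard = (T.filter (· ∈ S)).card := by
      rw [← Set.ncard_coe_finset]
      congr 1
      ext
      simp
    have := Finset.card_filter_add_card_filter_not (s := T) (· ∈ S)
    omega)
  refine ⟨σ, h1, fun v hv => ?_, h3, h4⟩
  have := h2 v hv
  exact ⟨this.1.1.resolve_left this.2, this.1.2⟩

/-- A minimum separator `T` of `X` from `ω` is linked back to `X`, on the far side from `ω`. -/
theorem exists_linking_of_min_separator {X : Set V} {T : Finset V}
    (hsep : SeparatesFromEnd G X T ω)
    (hmin : ∀ Z : Finset V, SeparatesFromEnd G X Z ω → T.card ≤ Z.card) :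
    ∃ σ : V → V, InjOn σ ((ω.beyond T)ᶜ \ X) ∧
      (∀ v ∈ (ω.beyond T)ᶜ \ X, σ v ∈ (ω.beyond T)ᶜ \ ↑T) ∧
      (∀ v ∈ (ω.beyond T)ᶜ \ X, σ v ≠ v → G.Adj v (σ v)) ∧
      {v ∈ (ω.beyond T)ᶜ \ X | σ v ≠ v}.Finite := by
  classical
  refine exists_linking G _ _ _ fun S hS Z hZ => ?_
  have hcut : SeparatesFromEnd G X ↑((T.filter (· ∉ S)) ∪ Z) ω := by
    intro R hR ⟨n, hn⟩
    have hex : ∃ i, R.f (n + i) ∈ T := by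
      obtain ⟨k, hk, hkT⟩ := hsep.exists_ge hR hn
      exact ⟨k - n, by rwa [Nat.add_sub_cancel' hk]⟩
    have hfirst := fun i (hi : i < Nat.find hex) => Nat.find_min hex hi
    have hm := Nat.find_spec hex
    generalize Nat.find hex = m at hfirst hm
    by_cases hmS : R.f (n + m) ∈ S
    swap
    · exact ⟨n + m, by simpa using Or.inl ⟨hm, hmS⟩⟩
    have hY : ∀ i < m, R.f (n + i) ∉ ω.beyond T := by
      intro i
      induction i with
      | zero => exact fun _ => hsep.notMem_beyond hn
      | succ i ih =>
        exact fun hi h => ih (by omega)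
          (GraphEnd.mem_beyond_of_adj h (R.adj _) (hfirst i (by omega)))
    obtain ⟨i, him, hi, hi'⟩ : ∃ i < m, R.f (n + i) ∉ S ∧ R.f (n + (i + 1)) ∈ S := by
      by_contra! hstep
      have : ∀ i ≤ m, R.f (n + i) ∉ S := by
        intro i
        induction i with
        | zero => exact fun _ h => (hS h).2 hn
        | succ i ih => exact fun hi => hstep i hi (ih (by omega))
      exact this m le_rfl hmS
    exact ⟨n + i, Finset.mem_coe.2 (Finset.mem_union_right _
      (hZ _ (hY i him) hi (hfirst i him) ⟨_, hi', (R.adj _).symm⟩))⟩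
  have hle := (hmin _ hcut).trans (Finset.card_union_le _ _)
  have hcard : (↑T ∩ S).ncard = (T.filter (· ∈ S)).card := by
    rw [← Set.ncard_coe_finset]
    congr 1
    ext
    simp
  have := Finset.card_filter_add_card_filter_not (s := T) (· ∈ S)
  omega

theorem GraphEnd.reachable (ω : GraphEnd G) {R R' : GraphRay G} (hR : R ∈ ω.rays)
    (hR' : R' ∈ ω.rays) (m n : ℕ) : G.Reachable (R.f m) (R'.f n) := by
  obtain ⟨i, j, w, -⟩ := (ω.mem_iff R hR R').1 hR' ∅ Set.finite_empty
  have h (R : GraphRay G) (k : ℕ) : G.Reachable (R.f 0) (R.f k) := ⟨(R.exists_walk k).choose⟩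
  exact (h R m).symm.trans ((h R i).trans (⟨w⟩ : G.Reachable _ _) |>.trans
    ((h R' j).symm.trans (h R' n)))

theorem antitone_beyond {T : ℕ → Finset V}
    (hsep : ∀ i, SeparatesFromEnd G (T i : Set V) (T (i + 1)) ω) :
    Antitone fun i => ω.beyond (T i) :=
  antitone_nat_of_succ_le fun i => (hsep i).beyond_subset

/-- Successive separators, each beyond the previous one, leave no vertex beyond all of them. -/
theorem exists_notMem_beyond {T : ℕ → Finset V}
    (hsub : ∀ i, (T (i + 1) : Set V) ⊆ ω.beyond (T i))
    (hsep : ∀ i, SeparatesFromEnd G (T i : Set V) (T (i + 1)) ω)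
    (h0 : ∃ R ∈ ω.rays, ∃ n, R.f n ∈ T 0) (v : V) : ∃ i, v ∉ ω.beyond (T i) := by
  by_contra! hv
  obtain ⟨R, hR, n, hn⟩ := h0
  obtain ⟨R', hR', rfl, -⟩ := hv 0
  have hstep : ∀ u w, G.Adj w u → (∀ i, u ∈ ω.beyond (T i)) → ∀ i, w ∈ ω.beyond (T i) := by
    intro u w hwu hu
    have hT : ∀ i, w ∉ T i := by
      intro i hi
      refine GraphEnd.notMem_of_mem_beyond ((hsep i).beyond_subset ?_) hi
      exact GraphEnd.mem_beyond_of_adj (hu (i + 1)) hwu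
        fun h => GraphEnd.notMem_of_mem_beyond (hsub i h) hi
    exact fun i => GraphEnd.mem_beyond_of_adj (hu i) hwu (hT i)
  obtain ⟨p⟩ := ω.reachable hR hR' n 0
  have hmem : ∀ {a b : V}, G.Walk a b → (∀ i, b ∈ ω.beyond (T i)) →
      ∀ i, a ∈ ω.beyond (T i) := by
    intro a b p
    induction p with
    | nil => exact id
    | cons h _ ih => exact fun hb => hstep _ _ h (ih hb)
  exact GraphEnd.notMem_of_mem_beyond (hmem p hv 0) hn

/-- A ray that gets beyond each of a sequence of separators exhausting the graph is an `ω`-ray. -/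
theorem mem_rays_of_forall_exists_mem_beyond {T : ℕ → Finset V}
    (hsep : ∀ i, SeparatesFromEnd G (T i : Set V) (T (i + 1)) ω)
    (hex : ∀ v, ∃ i, v ∉ ω.beyond (T i)) {Q : GraphRay G}
    (hQ : ∀ i, ∃ n, Q.f n ∈ ω.beyond (T i)) : Q ∈ ω.rays := by
  obtain ⟨R, hR⟩ := ω.nonempty
  refine (ω.mem_iff R hR Q).2 fun F hF => ?_
  choose i hi using hex
  obtain ⟨k, hk⟩ := (hF.image i).bddAbove
  obtain ⟨n, R', hR', h0, hT⟩ := hQ k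
  have hR'F : ∀ m, R'.f m ∉ F := fun m hm =>
    hi _ (antitone_beyond hsep (hk (Set.mem_image_of_mem i hm))
      (GraphEnd.mem_beyond hR' fun j _ => hT j))
  obtain ⟨a, b, w, hw⟩ := (ω.mem_iff R hR R').1 hR' F hF
  obtain ⟨w', hw'⟩ := R'.exists_walk b
  refine ⟨a, n, (w.append w'.reverse).copy rfl h0, fun x hx => ?_⟩
  rw [SimpleGraph.Walk.support_copy, SimpleGraph.Walk.mem_support_append_iff,
    SimpleGraph.Walk.support_reverse, List.mem_reverse] at hx
  rcases hx with hx | hx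
  · exact hw x hx
  · obtain ⟨m, rfl⟩ := hw' x hx
    exact hR'F m

/-- From a tight set there start disjoint `ω`-rays, one at each of its vertices. -/
theorem GraphEnd.IsTight.exists_rays (hundom : ∀ v : V, ¬ Dominates G v ω) {S : Finset V}
    (hS : ω.IsTight S) :
    ∃ R : S → GraphRay G, (∀ s, R s ∈ ω.rays ∧ (R s).f 0 = s ∧
        ∀ n, (R s).f (n + 1) ∈ ω.beyond S) ∧
      ∀ s t m n, (R s).f m = (R t).f n → s = t := by
  classical
  rcases S.eq_empty_or_nonempty with rfl | hne
  · exact ⟨fun s => absurd s.2 (Finset.notMem_empty _), fun s => absurd s.2 (Finset.notMem_empty _),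
      fun s => absurd s.2 (Finset.notMem_empty _)⟩
  have h0 : ∃ R ∈ ω.rays, ∃ n, R.f n ∈ S := by
    by_contra! h
    have := hS ∅ fun R hR ⟨n, hn⟩ => absurd hn (h R hR n)
    exact hne.card_pos.not_ge this
  obtain ⟨T, rfl, hsub, hsep, htight⟩ : ∃ T : ℕ → Finset V, T 0 = S ∧
      (∀ i, (T (i + 1) : Set V) ⊆ ω.beyond (T i)) ∧
      (∀ i, SeparatesFromEnd G (T i : Set V) (T (i + 1)) ω) ∧ ∀ i, ω.IsTight (T i) := by
    choose N h1 h2 h3 using exists_isTight_separator_beyond hundom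
    refine ⟨fun i => N^[i] S, rfl, fun i => ?_, fun i => ?_, fun i => ?_⟩
    · simp only [Function.iterate_succ_apply']
      exact h1 _
    · simp only [Function.iterate_succ_apply']
      exact h2 _
    · cases i with
      | zero => exact hS
      | succ i =>
        simp only [Function.iterate_succ_apply']
        exact h3 _
  have hex := exists_notMem_beyond hsub hsep h0
  have hanti := antitone_beyond hsep
  choose σ hσinj hσmem hσadj hσfin using fun i => (htight i).exists_linking (hsep i)
  set U : ℕ → Set V := fun i => ↑(T i) ∪ ω.beyond (T i)
  set L : ℕ → Set V := fun i => (U i \ ω.beyond (T (i + 1))) \ ↑(T (i + 1))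
  have hUsub : ∀ i, U (i + 1) ⊆ ω.beyond (T i) := fun i =>
    Set.union_subset (hsub i) (hsep i).beyond_subset
  have hUanti : Antitone U := antitone_nat_of_succ_le fun i =>
    (hUsub i).trans Set.subset_union_right
  have hLU : ∀ {i v}, v ∈ L i ↔ v ∈ U i ∧ v ∉ U (i + 1) := by
    intro i v
    simp only [L, U, Set.mem_sdiff, Set.mem_union]
    tauto
  have hUL : ∀ i, ∀ v ∈ U i, ∃ j ≥ i, v ∈ L j := by
    intro i v hv
    by_contra! h
    have hall : ∀ k, v ∈ U (i + k) := by
      intro k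
      induction k with
      | zero => exact hv
      | succ k ih =>
        by_contra hk
        exact h (i + k) (by omega) (hLU.2 ⟨ih, hk⟩)
    obtain ⟨j, hj⟩ := hex v
    exact hj (hUsub j (hUanti (by omega) (hall (j + 1))))
  have hLdisj : ∀ {i j v}, v ∈ L i → v ∈ L j → i = j := by
    intro i j v hi hj
    rw [hLU] at hi hj
    by_contra hij
    rcases Nat.lt_or_gt_of_ne hij with h | h
    · exact hi.2 (hUanti h hj.1)
    · exact hj.2 (hUanti h hi.1)
  obtain ⟨ρ, hρ⟩ : ∃ ρ : V → V, ∀ i, ∀ v ∈ L i, ρ v = σ i v := by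
    refine ⟨fun v => if h : ∃ i, v ∈ L i then σ h.choose v else v, fun i v hv => ?_⟩
    have h : ∃ i, v ∈ L i := ⟨i, hv⟩
    simp only [h, dite_true]
    rw [hLdisj h.choose_spec hv]
  have hρmem : ∀ i, ∀ v ∈ U i, ρ v ∈ ω.beyond (T i) := by
    intro i v hv
    obtain ⟨j, hj, hvj⟩ := hUL i v hv
    rw [hρ j v hvj]
    exact hanti hj (hσmem j v hvj).1
  have hρU : ∀ i, ∀ v ∈ U i, ρ v ∈ U i := fun i v hv => Or.inr (hρmem i v hv)
  have hρinj : InjOn ρ (U 0) := by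
    intro v hv w hw hvw
    obtain ⟨i, -, hi⟩ := hUL 0 v hv
    obtain ⟨j, -, hj⟩ := hUL 0 w hw
    rw [hρ i v hi, hρ j w hj] at hvw
    have h1 := hσmem i v hi
    have h2 := hσmem j w hj
    obtain rfl : i = j := by
      by_contra hij
      rcases Nat.lt_or_gt_of_ne hij with h | h
      · exact h1.2 (hanti h (hvw ▸ h2.1))
      · exact h2.2 (hanti h (hvw ▸ h1.1))
    exact hσinj i hi hj hvw
  have horb : ∀ s ∈ T 0, ∀ n, ρ^[n] s ∈ U 0 := by
    intro s hs n
    induction n with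
    | zero => exact Or.inl hs
    | succ n ih =>
      rw [Function.iterate_succ_apply']
      exact hρU 0 _ ih
  have hdisj : ∀ s ∈ T 0, ∀ t ∈ T 0, ∀ m n, ρ^[m] s = ρ^[n] t → m = n ∧ s = t :=
    fun s hs t ht m n h => iterate_eq_iterate_of_injOn hρinj (A := ↑(T 0))
      (fun v hv => GraphEnd.notMem_of_mem_beyond (hρmem 0 v hv)) hs ht
      (fun i _ => horb s hs i) (fun j _ => horb t ht j) h
  have hne : ∀ s ∈ T 0, ∀ n, ρ (ρ^[n] s) ≠ ρ^[n] s := by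
    intro s hs n h
    rw [← Function.iterate_succ_apply' ρ] at h
    exact absurd (hdisj s hs s hs _ _ h).1 (Nat.succ_ne_self n)
  let Q : T 0 → GraphRay G := fun s =>
    { f := fun n => ρ^[n] s
      inj := fun m n h => (hdisj s s.2 s s.2 m n h).1
      adj := fun n => by
        obtain ⟨i, -, hi⟩ := hUL 0 _ (horb s s.2 n)
        have hn := hne s s.2 n
        rw [Function.iterate_succ_apply']
        rw [hρ i _ hi] at hn ⊢
        exact hσadj i _ hi hn }
  refine ⟨Q, fun s => ⟨?_, rfl, fun n => ?_⟩, fun s t m n h =>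
    Subtype.ext (hdisj s s.2 t t.2 m n h).2⟩
  · have hlev : ∀ i, ∃ n, (Q s).f n ∈ U i := by
      intro i
      induction i with
      | zero => exact ⟨0, Or.inl s.2⟩
      | succ i ih =>
        by_contra! h
        obtain ⟨n, hn⟩ := ih
        have hall : ∀ k, (Q s).f (n + k) ∈ U i := by
          intro k
          induction k with
          | zero => exact hn
          | succ k ih =>
            have := hρU i _ ih
            rwa [← Function.iterate_succ_apply' ρ] at this
        refine Set.infinite_of_injective_forall_mem ((Q s).drop n).inj (fun k => ?_) (hσfin i)
        have hL : (Q s).f (n + k) ∈ L i := hLU.2 ⟨hall k, h _⟩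
        refine ⟨hL, ?_⟩
        have hne' := hne s s.2 (n + k)
        rwa [hρ i _ hL] at hne'
    exact mem_rays_of_forall_exists_mem_beyond hsep hex fun i =>
      (hlev (i + 1)).imp fun n hn => hUsub i hn
  · change ρ^[n + 1] s ∈ _
    rw [Function.iterate_succ_apply']
    exact hρmem 0 _ (horb s s.2 n)

/-- From a minimum separator `T` of `X` from `ω` there are disjoint paths back to `X` that stay
on the far side of `T` from `ω`. -/
theorem exists_paths_of_min_separator {X : Set V} {T : Finset V}
    (hsep : SeparatesFromEnd G X T ω)
    (hmin : ∀ Z : Finset V, SeparatesFromEnd G X Z ω → T.card ≤ Z.card) :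
    ∃ (l : T → ℕ) (p : T → ℕ → V), (∀ t, p t 0 = t ∧ p t (l t) ∈ X ∧
        (∀ j ≤ l t, p t j ∉ ω.beyond T) ∧ ∀ j < l t, G.Adj (p t j) (p t (j + 1))) ∧
      ∀ s t, ∀ i ≤ l s, ∀ j ≤ l t, p s i = p t j → i = j ∧ s = t := by
  classical
  obtain ⟨σ, hinj, hmem, hadj, hfin⟩ := exists_linking_of_min_separator hsep hmin
  have hA : ∀ v ∈ (ω.beyond T)ᶜ \ X, σ v ∉ (T : Set V) := fun v hv => (hmem v hv).2
  have hmemY : ∀ t : T, ∀ j, (∀ i < j, σ^[i] t ∉ X) → σ^[j] t ∈ (ω.beyond T)ᶜ := by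
    intro t j
    induction j with
    | zero => exact fun _ h => GraphEnd.notMem_of_mem_beyond h t.2
    | succ j ih =>
      intro h
      rw [Function.iterate_succ_apply']
      exact (hmem _ ⟨ih fun i hi => h i (by omega), h j (by omega)⟩).1
  have hex : ∀ t : T, ∃ j, σ^[j] t ∈ X := by
    intro t
    by_contra! h
    have hY : ∀ j, σ^[j] t ∈ (ω.beyond T)ᶜ \ X := fun j => ⟨hmemY t j fun i _ => h i, h j⟩
    have horb : Function.Injective fun j => σ^[j] (t : V) := fun i j hij =>
      (iterate_eq_iterate_of_injOn hinj hA t.2 t.2 (fun i _ => hY i) (fun j _ => hY j) hij).1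
    have hmoved : ∀ j, σ^[j] (t : V) ∈ {v ∈ (ω.beyond T)ᶜ \ X | σ v ≠ v} := by
      refine fun j => ⟨hY j, fun hj => ?_⟩
      rw [← Function.iterate_succ_apply' σ] at hj
      exact absurd (horb hj) (Nat.succ_ne_self j)
    exact Set.infinite_of_injective_forall_mem horb hmoved hfin
  have hY : ∀ t : T, ∀ j < Nat.find (hex t), σ^[j] t ∈ (ω.beyond T)ᶜ \ X := fun t j hj =>
    ⟨hmemY t j fun i hi => Nat.find_min (hex t) (hi.trans hj), Nat.find_min (hex t) hj⟩
  have hdisj : ∀ s t : T, ∀ i ≤ Nat.find (hex s), ∀ j ≤ Nat.find (hex t),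
      σ^[i] (s : V) = σ^[j] t → i = j ∧ s = t := by
    intro s t i hi j hj h
    obtain ⟨h1, h2⟩ := iterate_eq_iterate_of_injOn hinj hA s.2 t.2
      (fun i' h' => hY s i' (by omega)) (fun j' h' => hY t j' (by omega)) h
    exact ⟨h1, Subtype.ext h2⟩
  refine ⟨fun t => Nat.find (hex t), fun t j => σ^[j] t, fun t => ⟨rfl, Nat.find_spec (hex t),
    fun j hj => hmemY t j fun i hi => Nat.find_min (hex t) (hi.trans_le hj), fun j hj => ?_⟩, hdisj⟩
  have hne : σ (σ^[j] (t : V)) ≠ σ^[j] t := by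
    intro h
    rw [← Function.iterate_succ_apply' σ] at h
    exact absurd (hdisj t t _ hj _ hj.le h).1 (Nat.succ_ne_self j)
  change G.Adj (σ^[j] (t : V)) (σ^[j + 1] t)
  rw [Function.iterate_succ_apply']
  exact hadj _ (hY t j hj) hne

/-- A minimum separator `T` of `X` from `ω` has `|T|` disjoint `ω`-rays starting in `X`. -/
theorem exists_rays_of_min_separator (hundom : ∀ v : V, ¬ Dominates G v ω) {X : Set V}
    {T : Finset V} (hsep : SeparatesFromEnd G X T ω)
    (hmin : ∀ Z : Finset V, SeparatesFromEnd G X Z ω → T.card ≤ Z.card) :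
    ∃ R : T → GraphRay G, (∀ t, R t ∈ ω.rays ∧ (R t).f 0 ∈ X) ∧
      ∀ s t, s ≠ t → Disjoint (Set.range (R s).f) (Set.range (R t).f) := by
  classical
  have htight : ω.IsTight T := fun Z hZ => hmin Z (hsep.trans hZ)
  obtain ⟨Q, hQ, hQdisj⟩ := htight.exists_rays hundom
  obtain ⟨l, p, hp, hpdisj⟩ := exists_paths_of_min_separator hsep hmin
  let f : T → ℕ → V := fun t n => if n ≤ l t then p t (l t - n) else (Q t).f (n - l t)
  have hf1 : ∀ t n, n ≤ l t → f t n = p t (l t - n) := fun t n h => if_pos h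
  have hf2 : ∀ t n, l t ≤ n → f t n = (Q t).f (n - l t) := by
    intro t n h
    rcases h.eq_or_lt with rfl | h
    · rw [hf1 t _ le_rfl, Nat.sub_self, (hp t).1, (hQ t).2.1]
    · exact if_neg h.not_ge
  have hpQ : ∀ s t m n, m ≤ l s → l t < n → f s m ≠ f t n := by
    intro s t m n hm hn h
    rw [hf1 s m hm, hf2 t n hn.le] at h
    obtain ⟨k, rfl⟩ := Nat.exists_eq_add_of_lt hn
    have := (hQ t).2.2 k
    rw [show l t + k + 1 - l t = k + 1 by omega] at h
    exact (hp s).2.2.1 _ (Nat.sub_le _ _) (h ▸ this)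
  have hf : ∀ s t m n, f s m = f t n → m = n ∧ s = t := by
    intro s t m n h
    rcases le_or_gt m (l s) with hm | hm <;> rcases le_or_gt n (l t) with hn | hn
    · rw [hf1 s m hm, hf1 t n hn] at h
      obtain ⟨h1, rfl⟩ := hpdisj s t _ (Nat.sub_le _ _) _ (Nat.sub_le _ _) h
      exact ⟨by omega, rfl⟩
    · exact absurd h (hpQ s t m n hm hn)
    · exact absurd h.symm (hpQ t s n m hn hm)
    · rw [hf2 s m hm.le, hf2 t n hn.le] at h
      obtain rfl := hQdisj s t _ _ h
      have := (Q s).inj h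
      exact ⟨by omega, rfl⟩
  refine ⟨fun t => ⟨f t, fun m n h => (hf t t m n h).1, fun n => ?_⟩, fun t => ⟨?_, ?_⟩,
    fun s t hst => ?_⟩
  · rcases lt_or_ge n (l t) with hn | hn
    · rw [hf1 t n hn.le, hf1 t (n + 1) hn]
      have := (hp t).2.2.2 (l t - (n + 1)) (by omega)
      rw [show l t - (n + 1) + 1 = l t - n by omega] at this
      exact this.symm
    · rw [hf2 t n hn, hf2 t (n + 1) (by omega), show n + 1 - l t = n - l t + 1 by omega]
      exact (Q t).adj _
  · refine ω.mem_of_shift_eq (hQ t).1 0 (l t) fun n => ?_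
    change _ = f t (l t + n)
    rw [hf2 t _ (Nat.le_add_right _ _), zero_add, Nat.add_sub_cancel_left]
  · change f t 0 ∈ X
    rw [hf1 t 0 (Nat.zero_le _)]
    exact (hp t).2.1
  · refine Set.disjoint_left.2 ?_
    rintro _ ⟨m, rfl⟩ ⟨n, h⟩
    exact hst (hf t s n m h).2.symm

theorem card_le_of_disjoint_rays {X : Set V} {T : Finset V} (hT : SeparatesFromEnd G X T ω)
    {m : ℕ} {R : Fin m → GraphRay G} (hR : ∀ i, R i ∈ ω.rays ∧ (R i).f 0 ∈ X)
    (hdisj : ∀ i j, i ≠ j → Disjoint (Set.range (R i).f) (Set.range (R j).f)) :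
    m ≤ T.card := by
  choose n hn using fun i => hT (R i) (hR i).1 ⟨0, (hR i).2⟩
  have hinj : Function.Injective fun i => (R i).f (n i) := by
    intro i j hij
    by_contra hne
    exact Set.disjoint_left.1 (hdisj i j hne) ⟨n i, rfl⟩ ⟨n j, hij.symm⟩
  simpa using Finset.card_le_card_of_injOn (s := Finset.univ) _ (fun i _ => hn i) hinj.injOn

end

/-- Menger for an undominated end: the maximum number of disjoint
`ω`-rays starting in a finite set `X` equals the minimum size of a set
separating `X` from `ω`. -/
theorem menger_for_ends {V : Type u} (G : SimpleGraph V) (ω : GraphEnd G)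
    (hundom : ∀ v : V, ¬ Dominates G v ω) (X : Set V) (hX : X.Finite) :
    ∃ k : ℕ,
      IsGreatest {m : ℕ | ∃ R : Fin m → GraphRay G,
        (∀ i, R i ∈ ω.rays ∧ (R i).f 0 ∈ X) ∧
        ∀ i j, i ≠ j → Disjoint (Set.range (R i).f) (Set.range (R j).f)} k ∧
      IsLeast {t : ℕ | ∃ T : Finset V, T.card = t ∧
        SeparatesFromEnd G X (↑T) ω} k := by
  obtain ⟨T, hT, hmin⟩ := exists_min_separator ω hX.toFinset
  rw [hX.coe_toFinset] at hT hmin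
  obtain ⟨R, hR, hdisj⟩ := exists_rays_of_min_separator hundom hT hmin
  refine ⟨T.card, ⟨⟨R ∘ T.equivFin.symm, fun i => hR _, fun i j hij => hdisj _ _ ?_⟩, ?_⟩,
    ⟨T, rfl, hT⟩, ?_⟩
  · exact T.equivFin.symm.injective.ne hij
  · rintro m ⟨R', hR', hdisj'⟩
    exact card_le_of_disjoint_rays hT hR' hdisj'
  · rintro _ ⟨Z, rfl, hZ⟩
    exact hmin Z hZ
end

section
/- Let ω be an end of G and k ≤ deg(ω) + dom(ω) finite. Then there exist a set X ⊆ V of k vertices and a family R of pairwise disjoint ω-rays such that every vertex of X either is the start-vertex of a ray in R, or dominates ω and lies on no ray of R, and for any A,B ⊆ X there are min(|A|,|B|) pairwise disjoint A–B paths in G whose internal vertices meet no ray in R and no vertex of X. -/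
open Set

universe u

/-- `ReachIn r C a b`: there is a directed `r`-walk from `a` to `b` inside `C`. -/
def ReachIn {V : Type u} (r : V → V → Prop) (C : Set V) (a b : V) : Prop :=
  a ∈ C ∧ Relation.ReflTransGen (fun u v => r u v ∧ u ∈ C ∧ v ∈ C) a b

namespace ReachIn

variable {V : Type u} {r r' : V → V → Prop} {C C' : Set V} {a b c x y : V}

lemma refl (h : a ∈ C) : ReachIn r C a a := ⟨h, .refl⟩

lemma left_mem (h : ReachIn r C a b) : a ∈ C := h.1

lemma right_mem (h : ReachIn r C a b) : b ∈ C := by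
  rcases Relation.ReflTransGen.cases_tail h.2 with h' | ⟨c, -, h'⟩
  · exact h' ▸ h.1
  · exact h'.2.2

lemma trans (h : ReachIn r C a b) (h' : ReachIn r C b c) : ReachIn r C a c :=
  ⟨h.1, h.2.trans h'.2⟩

lemma tail (h : ReachIn r C a b) (hr : r b c) (hc : c ∈ C) : ReachIn r C a c :=
  ⟨h.1, h.2.tail ⟨hr, h.right_mem, hc⟩⟩

@[elab_as_elim]
lemma induction {P : V → Prop} (h : ReachIn r C a b) (base : a ∈ C → P a)
    (step : ∀ c d, ReachIn r C a c → r c d → d ∈ C → P c → P d) : P b := by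
  obtain ⟨ha, h⟩ := h
  induction h with
  | refl => exact base ha
  | tail h₁ h₂ ih => exact step _ _ ⟨ha, h₁⟩ h₂.1 h₂.2.2 ih

lemma imp (h : ReachIn r C a b) (ha : a ∈ C')
    (H : ∀ u v, r u v → u ∈ C → v ∈ C → r' u v ∧ v ∈ C') : ReachIn r' C' a b :=
  h.induction (fun _ => .refl ha) fun c d hc hr hd ih =>
    ih.tail (H c d hr hc.right_mem hd).1 (H c d hr hc.right_mem hd).2

lemma mono (h : ReachIn r C a b) (H : C ⊆ C') : ReachIn r C' a b :=
  h.imp (H h.1) fun _ _ hr _ hv => ⟨hr, H hv⟩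

lemma flip (h : ReachIn r C a b) : ReachIn (flip r) C b a := by
  refine h.induction (fun h => .refl h) fun c d hc hr hd ih => ?_
  exact ((ReachIn.refl hd).tail (show Function.swap r d c from hr) hc.right_mem).trans ih

lemma symm (hr : ∀ u v, r u v → r v u) (h : ReachIn r C a b) : ReachIn r C b a :=
  h.flip.imp h.right_mem fun _ _ h _ hv => ⟨hr _ _ h, hv⟩

/-- A walk either avoids `S` or visits `S`. -/
lemma avoids_or_visits (h : ReachIn r C a b) (S : Set V) :
    ReachIn r Sᶜ a b ∨ ∃ s ∈ S, ReachIn r C a s ∧ ReachIn r C s b := by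
  refine h.induction (fun ha => ?_) fun c d hc hr hd ih => ?_
  · by_cases haS : a ∈ S
    · exact .inr ⟨a, haS, .refl ha, .refl ha⟩
    · exact .inl (.refl haS)
  · rcases ih with ih | ⟨s, hs, h₁, h₂⟩
    · by_cases hdS : d ∈ S
      · exact .inr ⟨d, hdS, hc.tail hr hd, .refl hd⟩
      · exact .inl (ih.tail hr hdS)
    · exact .inr ⟨s, hs, h₁, h₂.tail hr hd⟩

/-- The part of `C` reached before the first visit to `b` suffices to reach `b`. -/
lemma exists_trim (h : ReachIn r C a b) : ∃ C₁ ⊆ C, ReachIn r C₁ a b ∧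
    ∀ z ∈ C₁, z = b ∨ ReachIn r (C \ {b}) a z := by
  set C₁ : Set V := insert b {z | ReachIn r (C \ {b}) a z}
  have key : ReachIn r C₁ a b ∨ (ReachIn r (C \ {b}) a b ∧ ReachIn r C₁ a b) := by
    refine h.induction (P := fun c => ReachIn r C₁ a b ∨
      (ReachIn r (C \ {b}) a c ∧ ReachIn r C₁ a c)) (fun ha => ?_) fun c d hc hr hd ih => ?_
    · by_cases hab : a = b
      · subst hab
        exact .inl (.refl (mem_insert _ _))
      · have : ReachIn r (C \ {b}) a a := .refl ⟨ha, hab⟩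
        exact .inr ⟨this, .refl (mem_insert_of_mem _ this)⟩
    · rcases ih with ih | ⟨h₁, h₂⟩
      · exact .inl ih
      · by_cases hdb : d = b
        · subst hdb
          exact .inl (h₂.tail hr (mem_insert _ _))
        · have := h₁.tail hr (show d ∈ C \ {b} from ⟨hd, hdb⟩)
          exact .inr ⟨this, h₂.tail hr (mem_insert_of_mem _ this)⟩
  refine ⟨C₁, ?_, key.elim id And.right, fun z hz => hz⟩
  rintro z (rfl | hz)
  · exact h.right_mem
  · exact (right_mem hz).1

lemma exists_trim_left (h : ReachIn r C a b) : ∃ C₁ ⊆ C, ReachIn r C₁ a b ∧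
    ∀ z ∈ C₁, z = a ∨ ReachIn r (C \ {a}) z b := by
  obtain ⟨C₁, h₁, h₂, h₃⟩ := h.flip.exists_trim
  exact ⟨C₁, h₁, h₂.flip, fun z hz => (h₃ z hz).imp id flip⟩

lemma of_insert {E : Finset (V × V)} [DecidableEq V]
    (h : ReachIn (fun u v => (u, v) ∈ insert (x, y) E) C a b) :
    ReachIn (fun u v => (u, v) ∈ E) C a b ∨
      (ReachIn (fun u v => (u, v) ∈ E) C a x ∧ ReachIn (fun u v => (u, v) ∈ E) C y b) := by
  refine h.induction (fun ha => .inl (.refl ha)) fun c d hc hr hd ih => ?_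
  rcases Finset.mem_insert.1 hr with he | he
  · obtain ⟨rfl, rfl⟩ := Prod.mk.inj he
    exact .inr ⟨ih.elim id And.left, .refl hd⟩
  · exact ih.imp (fun h => h.tail he hd) fun h => ⟨h.1, h.2.tail he hd⟩

lemma of_walk {G : SimpleGraph V} (w : G.Walk a b) (hw : ∀ z ∈ w.support, z ∈ C) :
    ReachIn G.Adj C a b := by
  induction w with
  | nil => exact .refl (hw _ (by simp))
  | cons h p ih =>
    have h₁ := ih fun z hz => hw z (by simp [hz])
    exact ((ReachIn.refl (hw _ (by simp))).tail h h₁.left_mem).trans h₁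

lemma exists_walk {G : SimpleGraph V} (h : ReachIn G.Adj C a b) :
    ∃ w : G.Walk a b, ∀ z ∈ w.support, z ∈ C := by
  refine h.induction (fun ha => ⟨.nil, by simpa using ha⟩) fun c d hc hr hd ih => ?_
  obtain ⟨w, hw⟩ := ih
  refine ⟨w.concat hr, fun z hz => ?_⟩
  rw [SimpleGraph.Walk.support_concat] at hz
  simp only [List.mem_append, List.mem_singleton] at hz
  rcases hz with hz | rfl
  exacts [hw z hz, hd]

end ReachIn

/-- There are `k` pairwise disjoint vertex sets, each containing a directed walk from `A` to `B`. -/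
def HasLinkage {V : Type u} (r : V → V → Prop) (A B : Finset V) (k : ℕ) : Prop :=
  ∃ (a b : Fin k → V) (C : Fin k → Set V), (∀ i, a i ∈ A) ∧ (∀ i, b i ∈ B) ∧
    (∀ i j z, z ∈ C i → z ∈ C j → i = j) ∧ ∀ i, ReachIn r (C i) (a i) (b i)

lemma exists_eq_of_injective_of_card_eq {V : Type u} {k : ℕ} {X : Finset V} {b : Fin k → V}
    (hb : Function.Injective b) (hX : ∀ i, b i ∈ X) (hk : X.card = k) {x : V} (hx : x ∈ X) :
    ∃ i, b i = x := by
  obtain ⟨i, -, hi⟩ := Finset.surj_on_of_inj_on_of_card_le (s := Finset.univ) (t := X)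
    (fun i _ => b i) (fun i _ => hX i) (fun i j _ _ h => hb h) (by simp [hk]) x hx
  exact ⟨i, hi.symm⟩

/-- Menger's theorem for finite directed graphs, by induction on the number of edges. -/
theorem menger {V : Type u} (E : Finset (V × V)) (A B : Finset V) (k : ℕ)
    (h : ∀ S : Finset V, S.card < k →
      ∃ a ∈ A, ∃ b ∈ B, ReachIn (fun u v => (u, v) ∈ E) (↑S)ᶜ a b) :
    HasLinkage (fun u v => (u, v) ∈ E) A B k := by
  classical
  induction E using Finset.induction_on generalizing A B with
  | empty =>
    have hk : k ≤ (A ∩ B).card := by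
      by_contra! hlt
      obtain ⟨a, ha, b, hb, hr⟩ := h _ hlt
      have hab : a = b := hr.induction (fun _ => rfl) fun c d _ h => by simp at h
      subst hab
      exact hr.left_mem (by simp [ha, hb])
    obtain ⟨f, hf, hfr⟩ : ∃ f : Fin k → V, Function.Injective f ∧ ∀ i, f i ∈ A ∩ B :=
      ⟨fun i => (A ∩ B).equivFin.symm (Fin.castLE hk i),
        Subtype.val_injective.comp ((Equiv.injective _).comp (Fin.castLE_injective hk)),
        fun i => Subtype.prop _⟩
    refine ⟨f, f, fun i => {f i}, fun i => (Finset.mem_inter.1 (hfr i)).1,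
      fun i => (Finset.mem_inter.1 (hfr i)).2, ?_, fun i => .refl rfl⟩
    rintro i j z rfl hz
    exact hf hz
  | insert e E he ih =>
    obtain ⟨x, y⟩ := e
    by_cases h' : ∀ S : Finset V, S.card < k →
      ∃ a ∈ A, ∃ b ∈ B, ReachIn (fun u v => (u, v) ∈ E) (↑S)ᶜ a b
    · obtain ⟨a, b, C, ha, hb, hC, hr⟩ := ih A B h'
      exact ⟨a, b, C, ha, hb, hC, fun i => (hr i).imp (hr i).left_mem
        fun u v huv _ hv => ⟨Finset.mem_insert_of_mem huv, hv⟩⟩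
    push Not at h'
    obtain ⟨S, hSk, hS⟩ := h'
    have hx : ∀ T : Finset V, T.card < k →
        ∃ a ∈ A, ∃ b ∈ insert x S, ReachIn (fun u v => (u, v) ∈ E) (↑T)ᶜ a b := by
      intro T hT
      obtain ⟨a, ha, b, hb, hr⟩ := h T hT
      rcases hr.of_insert with hr | ⟨hr, -⟩
      · rcases hr.avoids_or_visits S with h₁ | ⟨s, hs, h₁, -⟩
        · exact (hS a ha b hb h₁).elim
        · exact ⟨a, ha, s, Finset.mem_insert_of_mem hs, h₁⟩
      · exact ⟨a, ha, x, Finset.mem_insert_self _ _, hr⟩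
    have hy : ∀ T : Finset V, T.card < k →
        ∃ a ∈ insert y S, ∃ b ∈ B, ReachIn (fun u v => (u, v) ∈ E) (↑T)ᶜ a b := by
      intro T hT
      obtain ⟨a, ha, b, hb, hr⟩ := h T hT
      rcases hr.of_insert with hr | ⟨-, hr⟩
      · rcases hr.avoids_or_visits S with h₁ | ⟨s, hs, -, h₁⟩
        · exact (hS a ha b hb h₁).elim
        · exact ⟨s, Finset.mem_insert_of_mem hs, b, hb, h₁⟩
      · exact ⟨y, Finset.mem_insert_self _ _, b, hb, hr⟩
    have hxk : k ≤ (insert x S).card := by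
      by_contra! hlt
      obtain ⟨a, ha, b, hb, hr⟩ := hx _ hlt
      exact hr.right_mem hb
    have hyk : k ≤ (insert y S).card := by
      by_contra! hlt
      obtain ⟨a, ha, b, hb, hr⟩ := hy _ hlt
      exact hr.left_mem ha
    have hxS : x ∉ S := fun hxS => by rw [Finset.insert_eq_of_mem hxS] at hxk; omega
    have hyS : y ∉ S := fun hyS => by rw [Finset.insert_eq_of_mem hyS] at hyk; omega
    have hxc : (insert x S).card = k := by
      rw [Finset.card_insert_of_notMem hxS] at *; omega
    have hyc : (insert y S).card = k := by
      rw [Finset.card_insert_of_notMem hyS] at *; omega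
    obtain ⟨a, b, C, ha, hb, hC, hr⟩ := ih A (insert x S) hx
    obtain ⟨a', b', C', ha', hb', hC', hr'⟩ := ih (insert y S) B hy
    have hbinj : Function.Injective b := fun i j hij =>
      hC i j (b i) (hr i).right_mem (hij ▸ (hr j).right_mem)
    have hainj : Function.Injective a' := fun i j hij =>
      hC' i j (a' i) (hr' i).left_mem (hij ▸ (hr' j).left_mem)
    have hCS : ∀ i, ∀ s ∈ C i, s ∈ S → s = b i := fun i s hs hsS => by
      obtain ⟨j, rfl⟩ := exists_eq_of_injective_of_card_eq hbinj hb hxc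
        (Finset.mem_insert_of_mem hsS)
      rw [hC i j _ hs (hr j).right_mem]
    have hCS' : ∀ i, ∀ s ∈ C' i, s ∈ S → s = a' i := fun i s hs hsS => by
      obtain ⟨j, rfl⟩ := exists_eq_of_injective_of_card_eq hainj ha' hyc
        (Finset.mem_insert_of_mem hsS)
      rw [hC' i j _ hs (hr' j).left_mem]
    choose C₁ hC₁ hr₁ ht₁ using fun i => (hr i).exists_trim
    choose C₂ hC₂ hr₂ ht₂ using fun i => (hr' i).exists_trim_left
    have hreach₁ : ∀ i, ∀ z ∈ C₁ i, z ∉ S →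
        ReachIn (fun u v => (u, v) ∈ E) (↑S)ᶜ (a i) z := by
      intro i z hz hzS
      rcases ht₁ i z hz with rfl | hz
      · exact (hr i).mono fun s hs hsS => hzS (hCS i s hs hsS ▸ hsS)
      · exact hz.mono fun s hs hsS => hs.2 (hCS i s hs.1 hsS)
    have hreach₂ : ∀ i, ∀ z ∈ C₂ i, z ∉ S →
        ReachIn (fun u v => (u, v) ∈ E) (↑S)ᶜ z (b' i) := by
      intro i z hz hzS
      rcases ht₂ i z hz with rfl | hz
      · exact (hr' i).mono fun s hs hsS => hzS (hCS' i s hs hsS ▸ hsS)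
      · exact hz.mono fun s hs hsS => hs.2 (hCS' i s hs.1 hsS)
    have hσ : ∀ i, ∃ j, a' j = if b i = x then y else b i := fun i => by
      refine exists_eq_of_injective_of_card_eq hainj ha' hyc ?_
      have := hb i
      split_ifs with hbx
      · exact Finset.mem_insert_self _ _
      · exact Finset.mem_insert_of_mem ((Finset.mem_insert.1 this).resolve_left hbx)
    choose σ hσ using hσ
    have hσinj : Function.Injective σ := by
      intro i j hij
      apply hbinj
      have h₁ := hσ i
      rw [hij, hσ j] at h₁
      have hbi := Finset.mem_insert.1 (hb i)
      have hbj := Finset.mem_insert.1 (hb j)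
      split_ifs at h₁ with h₂ h₃ h₃ <;> grind
    have hcross : ∀ i j z, z ∈ C₁ i → z ∈ C₂ (σ j) → i = j := by
      intro i j z hz₁ hz₂
      by_cases hzS : z ∈ S
      · have h₁ := hCS i z (hC₁ i hz₁) hzS
        have h₂ := hCS' _ z (hC₂ _ hz₂) hzS
        rw [hσ j] at h₂
        apply hbinj
        split_ifs at h₂ <;> grind
      · exact (hS _ (ha i) _ (hb' _)
          ((hreach₁ i z hz₁ hzS).trans (hreach₂ _ z hz₂ hzS))).elim
    refine ⟨a, b' ∘ σ, fun i => C₁ i ∪ C₂ (σ i), ha, fun i => hb' _, ?_, fun i => ?_⟩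
    · rintro i j z (h₁ | h₁) (h₂ | h₂)
      · exact hC i j z (hC₁ i h₁) (hC₁ j h₂)
      · exact hcross i j z h₁ h₂
      · exact (hcross j i z h₂ h₁).symm
      · exact hσinj (hC' _ _ z (hC₂ _ h₁) (hC₂ _ h₂))
    · have lift : ∀ {D : Set V} {u v : V}, ReachIn (fun u v => (u, v) ∈ E) D u v →
          D ⊆ C₁ i ∪ C₂ (σ i) →
          ReachIn (fun u v => (u, v) ∈ insert (x, y) E) (C₁ i ∪ C₂ (σ i)) u v :=
        fun hr hD => (hr.mono hD).imp (hD hr.left_mem)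
          fun _ _ h _ hv => ⟨Finset.mem_insert_of_mem h, hv⟩
      have h₁ := lift (hr₁ i) subset_union_left
      have h₂ := lift (hr₂ (σ i)) subset_union_right
      have h₃ := hσ i
      split_ifs at h₃ with hbx
      · rw [hbx] at h₁
        rw [h₃] at h₂
        exact (h₁.tail (Finset.mem_insert_self _ _) h₂.left_mem).trans h₂
      · rw [h₃] at h₂
        exact h₁.trans h₂

lemma exists_disjoint_of_card_lt {V : Type u} {ι : Type*} (I : Finset ι) (P : ι → Set V)
    (hP : ∀ i ∈ I, ∀ j ∈ I, ∀ z, z ∈ P i → z ∈ P j → i = j) (S : Finset V)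
    (hS : S.card < I.card) : ∃ i ∈ I, P i ⊆ (↑S)ᶜ := by
  by_contra! h
  simp only [not_subset, mem_compl_iff, not_not, Finset.mem_coe] at h
  have : Nonempty V := by
    obtain ⟨i, hi⟩ := Finset.card_pos.1 (hS.trans_le' (Nat.zero_le _))
    exact ⟨(h i hi).choose⟩
  choose! f hf hfS using h
  obtain ⟨i, hi, j, hj, hne, hij⟩ := Finset.exists_ne_map_eq_of_card_lt_of_maps_to hS hfS
  exact hne (hP i hi j hj (f i) (hf i hi) (hij ▸ hf j hj))

/-- If each vertex of `X` has a leg attaching it to every one of `|X|` disjoint hubs, and the legs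
are disjoint, then `X` is highly linked by paths with no internal vertex in `Z`. -/
lemma linked_of_hubs {V : Type u} (G : SimpleGraph V) (X : Finset V) (P : V → Finset V)
    (H : ℕ → Finset V) (Z : Set V)
    (hP : ∀ x ∈ X, ∀ y ∈ X, ∀ z, z ∈ P x → z ∈ P y → x = y)
    (hH : ∀ i j z, z ∈ H i → z ∈ H j → i = j)
    (hne : ∀ j, (H j).Nonempty) (hxP : ∀ x ∈ X, x ∈ P x)
    (hreach : ∀ x ∈ X, ∀ j < X.card, ∀ h ∈ H j, ReachIn G.Adj (↑(P x) ∪ ↑(H j)) x h)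
    (hPZ : ∀ x ∈ X, ∀ z ∈ P x, z ≠ x → z ∉ Z) (hHZ : ∀ j < X.card, ∀ z ∈ H j, z ∉ Z)
    (A B : Finset V) (hA : A ⊆ X) (hB : B ⊆ X) :
    ∃ (a b : Fin (min A.card B.card) → V) (p : ∀ i, G.Walk (a i) (b i)),
      (∀ i, a i ∈ A) ∧ (∀ i, b i ∈ B) ∧ (∀ i, (p i).IsPath) ∧
      (∀ i j, i ≠ j → ∀ x, x ∈ (p i).support → x ∉ (p j).support) ∧
      ∀ i, ∀ x ∈ (p i).support, x ≠ a i → x ≠ b i → x ∉ Z := by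
  classical
  obtain ⟨A', hA', hAc⟩ := Finset.exists_subset_card_eq (min_le_left A.card B.card)
  obtain ⟨B', hB', hBc⟩ := Finset.exists_subset_card_eq (min_le_right A.card B.card)
  have hAX := hA'.trans hA
  have hBX := hB'.trans hB
  set k := min A.card B.card
  have hkX : k ≤ X.card := hAc ▸ Finset.card_le_card hAX
  set W : Finset V := (A' ∪ B').biUnion P ∪ (Finset.range X.card).biUnion H
  have hPW : ∀ x ∈ A' ∪ B', P x ⊆ W := fun x hx =>
    (Finset.subset_biUnion_of_mem P hx).trans Finset.subset_union_left
  have hHW : ∀ j < X.card, H j ⊆ W := fun j hj =>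
    (Finset.subset_biUnion_of_mem H (Finset.mem_range.2 hj)).trans Finset.subset_union_right
  set E : Finset (V × V) := (W ×ˢ W).filter fun e => G.Adj e.1 e.2
  have hE : ∀ u v, (u, v) ∈ E ↔ (u ∈ W ∧ v ∈ W) ∧ G.Adj u v := fun u v => by
    simp [E]
  have hlink : HasLinkage (fun u v => (u, v) ∈ E) A' B' k := by
    refine menger E A' B' k fun S hS => ?_
    obtain ⟨a, ha, haS⟩ := exists_disjoint_of_card_lt A' (fun x => (P x : Set V))
      (fun x hx y hy z => hP x (hAX hx) y (hAX hy) z) S (hAc ▸ hS)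
    obtain ⟨b, hb, hbS⟩ := exists_disjoint_of_card_lt B' (fun x => (P x : Set V))
      (fun x hx y hy z => hP x (hBX hx) y (hBX hy) z) S (hBc ▸ hS)
    obtain ⟨j, hj, hjS⟩ := exists_disjoint_of_card_lt (Finset.range X.card)
      (fun j => (H j : Set V)) (fun i _ j _ z => hH i j z) S (by simpa using hS.trans_le hkX)
    rw [Finset.mem_range] at hj
    obtain ⟨h, hh⟩ := hne j
    have leg : ∀ x ∈ A' ∪ B', (P x : Set V) ⊆ (↑S)ᶜ → x ∈ X →
        ReachIn (fun u v => (u, v) ∈ E) (↑S)ᶜ x h := fun x hx hxS hxX => by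
      have hsub : (↑(P x) ∪ ↑(H j) : Set V) ⊆ W :=
        union_subset (by exact_mod_cast hPW x hx) (by exact_mod_cast hHW j hj)
      exact (hreach x hxX j hj h hh).imp (hxS (hxP x hxX)) fun u v huv hu hv =>
        ⟨(hE u v).2 ⟨⟨hsub hu, hsub hv⟩, huv⟩, union_subset hxS hjS hv⟩
    refine ⟨a, ha, b, hb, (leg a (Finset.mem_union_left _ ha) haS (hAX ha)).trans
      ((leg b (Finset.mem_union_right _ hb) hbS (hBX hb)).symm fun u v huv => ?_)⟩
    rw [hE] at huv ⊢
    exact ⟨huv.1.symm, huv.2.symm⟩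
  obtain ⟨a, b, C, ha, hb, hC, hr⟩ := hlink
  have hainj : Function.Injective a := fun i j hij =>
    hC i j (a i) (hr i).left_mem (hij ▸ (hr j).left_mem)
  have hbinj : Function.Injective b := fun i j hij =>
    hC i j (b i) (hr i).right_mem (hij ▸ (hr j).right_mem)
  have hw : ∀ i, ∃ p : G.Walk (a i) (b i), p.IsPath ∧ ∀ z ∈ p.support, z ∈ C i ∩ W := by
    intro i
    have haW : a i ∈ W := hPW _ (Finset.mem_union_left _ (ha i)) (hxP _ (hAX (ha i)))
    obtain ⟨w, hw⟩ := ((hr i).imp (r' := G.Adj) (C' := C i ∩ W) ⟨(hr i).left_mem, haW⟩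
      fun u v huv _ hv => ⟨((hE u v).1 huv).2, hv, ((hE u v).1 huv).1.2⟩).exists_walk
    exact ⟨w.bypass, w.bypass_isPath, fun z hz => hw z (w.support_bypass_subset_support hz)⟩
  choose p hp hpC using hw
  refine ⟨a, b, p, fun i => hA' (ha i), fun i => hB' (hb i), hp,
    fun i j hij x hxi hxj => hij (hC i j x (hpC i x hxi).1 (hpC j x hxj).1),
    fun i x hx hxa hxb hxZ => ?_⟩
  obtain ⟨hxC, hxW⟩ := hpC i x hx
  have hxAB : x ∈ A' ∪ B' := by
    rcases Finset.mem_union.1 hxW with hxW | hxW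
    · obtain ⟨y, hy, hxy⟩ := Finset.mem_biUnion.1 hxW
      by_cases hne : x = y
      · exact hne ▸ hy
      · exact (hPZ y (Finset.union_subset hAX hBX hy) x hxy hne hxZ).elim
    · obtain ⟨j, hj, hxj⟩ := Finset.mem_biUnion.1 hxW
      exact (hHZ j (Finset.mem_range.1 hj) x hxj hxZ).elim
  rcases Finset.mem_union.1 hxAB with hx' | hx'
  · obtain ⟨j, rfl⟩ := exists_eq_of_injective_of_card_eq hainj ha hAc hx'
    exact hxa (congrArg a (hC j i _ (hr j).left_mem hxC))
  · obtain ⟨j, rfl⟩ := exists_eq_of_injective_of_card_eq hbinj hb hBc hx'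
    exact hxb (congrArg b (hC j i _ (hr j).right_mem hxC))

namespace GraphRay

variable {V : Type u} {G : SimpleGraph V}

lemma exists_forall_ge_notMem (R : GraphRay G) {F : Set V} (hF : F.Finite) :
    ∃ N, ∀ n ≥ N, R.f n ∉ F := by
  obtain ⟨N, hN⟩ := (hF.preimage R.inj.injOn).bddAbove
  exact ⟨N + 1, fun n hn hmem => by have := hN hmem; omega⟩

/-- The tail of a ray starting at its `N`-th vertex. -/
def drop_s13 (R : GraphRay G) (N : ℕ) : GraphRay G where
  f n := R.f (N + n)
  inj _ _ h := Nat.add_left_cancel (R.inj h)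
  adj n := R.adj (N + n)

lemma reachIn (R : GraphRay G) {C : Set V} {m n : ℕ} (hmn : m ≤ n)
    (h : ∀ l, m ≤ l → l ≤ n → R.f l ∈ C) : ReachIn G.Adj C (R.f m) (R.f n) := by
  induction n, hmn using Nat.le_induction with
  | base => exact .refl (h m le_rfl le_rfl)
  | succ n hmn ih =>
    exact (ih fun l h₁ h₂ => h l h₁ (by omega)).tail (R.adj n) (h _ (by omega) le_rfl)

lemma drop_mem {ω : GraphEnd G} {R : GraphRay G} (hR : R ∈ ω.rays) (N : ℕ) :
    R.drop_s13 N ∈ ω.rays := by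
  refine (ω.mem_iff R hR _).2 fun F hF => ?_
  obtain ⟨M, hM⟩ := R.exists_forall_ge_notMem hF
  refine ⟨N + M, M, (.nil : G.Walk (R.f (N + M)) (R.f (N + M))), fun x hx => ?_⟩
  have hx : x = R.f (N + M) := List.mem_singleton.1 hx
  exact hx ▸ hM _ (by omega)

/-- Outside a finite set, the tails of two rays of the same end are connected. -/
lemma exists_reachIn {ω : GraphEnd G} {R R' : GraphRay G} (hR : R ∈ ω.rays) (hR' : R' ∈ ω.rays)
    {F : Set V} (hF : F.Finite) {M M' : ℕ} (hM : ∀ n ≥ M, R.f n ∉ F)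
    (hM' : ∀ n ≥ M', R'.f n ∉ F) : ReachIn G.Adj Fᶜ (R.f M) (R'.f M') := by
  obtain ⟨m, n, w, hw⟩ := (ω.mem_iff R hR R').1 hR' (F ∪ R.f '' Iio M ∪ R'.f '' Iio M')
    ((hF.union ((finite_Iio M).image _)).union ((finite_Iio M').image _))
  have hm : M ≤ m := by
    by_contra! h
    exact hw _ w.start_mem_support (.inl (.inr ⟨m, h, rfl⟩))
  have hn : M' ≤ n := by
    by_contra! h
    exact hw _ w.end_mem_support (.inr ⟨n, h, rfl⟩)
  refine ((R.reachIn hm fun l hl _ => hM l hl).trans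
    (.of_walk w fun z hz hzF => hw z hz (.inl (.inl hzF)))).trans ?_
  exact (R'.reachIn hn fun l hl _ => hM' l hl).symm fun _ _ h => h.symm

end GraphRay

lemma Dominates.exists_adj_reachIn {V : Type u} {G : SimpleGraph V} {ω : GraphEnd G} {v : V}
    (hv : Dominates G v ω) {F : Set V} (hF : F.Finite) (hvF : v ∈ F) {R₀ : GraphRay G}
    (hR₀ : R₀ ∈ ω.rays) {M : ℕ} (hM : ∀ n ≥ M, R₀.f n ∉ F) :
    ∃ w, G.Adj v w ∧ ReachIn G.Adj Fᶜ (R₀.f M) w := by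
  obtain ⟨R, hR, p, hp, hinj, hdisj⟩ := hv
  obtain ⟨N, hN⟩ := R.exists_forall_ge_notMem hF
  have hfin : ((⋃ z ∈ F, {i | z ≠ v ∧ z ∈ (p i).2.support}) ∪
      (fun i => (p i).1) ⁻¹' Iio N).Finite := by
    refine (hF.biUnion fun z _ => Subsingleton.finite ?_).union
      ((finite_Iio N).preimage hinj.injOn)
    rintro i ⟨hz, hi⟩ j ⟨-, hj⟩
    by_contra hij
    exact hz (hdisj i j hij z hi hj)
  obtain ⟨i, hi⟩ := hfin.exists_notMem
  have hiN : N ≤ (p i).1 := by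
    by_contra! h
    exact hi (.inr h)
  have hiF : ∀ z ∈ (p i).2.support, z ∈ F → z = v := by
    intro z hz hzF
    by_contra hzv
    exact hi (.inl (mem_biUnion hzF ⟨hzv, hz⟩))
  have hend := hN _ hiN
  have hpath := hp i
  have hback := GraphRay.exists_reachIn hR₀ hR hF hM fun n hn => hN n (le_trans hiN hn)
  generalize (p i).2 = q at hiF hpath
  generalize R.f (p i).1 = e at *
  cases q with
  | nil => exact (hend hvF).elim
  | @cons _ w _ h q =>
    rw [SimpleGraph.Walk.cons_isPath_iff] at hpath
    refine ⟨w, h, hback.trans ((ReachIn.of_walk (C := Fᶜ) q fun z hz hzF => ?_).symm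
      fun _ _ h => h.symm)⟩
    exact hpath.2 (hiF z (by simp [hz]) hzF ▸ hz)

/-- Finitely many vertices connected outside `F` lie in a finite connected set avoiding `F`. -/
lemma exists_finset_connected {V : Type u} (G : SimpleGraph V) {F : Set V} {c : V}
    (Y : Finset V) (hc : c ∉ F) (hY : ∀ y ∈ Y, ReachIn G.Adj Fᶜ c y) :
    ∃ C : Finset V, (∀ z ∈ C, z ∉ F) ∧ C.Nonempty ∧ Y ⊆ C ∧
      ∀ u ∈ C, ∀ v ∈ C, ReachIn G.Adj ↑C u v := by
  classical
  suffices h : ∃ C : Finset V, (∀ z ∈ C, z ∉ F) ∧ c ∈ C ∧ Y ⊆ C ∧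
      ∀ u ∈ C, ReachIn G.Adj ↑C c u by
    obtain ⟨C, h₁, h₂, h₃, h₄⟩ := h
    exact ⟨C, h₁, ⟨c, h₂⟩, h₃, fun u hu v hv =>
      ((h₄ u hu).symm fun _ _ h => h.symm).trans (h₄ v hv)⟩
  induction Y using Finset.induction_on with
  | empty => exact ⟨{c}, by simpa using hc, by simp, by simp, by
      simp only [Finset.mem_singleton, forall_eq]
      exact .refl (by simp)⟩
  | insert y Y _ ih =>
    obtain ⟨C, h₁, h₂, h₃, h₄⟩ := ih fun z hz => hY z (Finset.mem_insert_of_mem hz)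
    obtain ⟨w, hw⟩ := (hY y (Finset.mem_insert_self _ _)).exists_walk
    refine ⟨C ∪ w.support.toFinset, fun z hz => ?_, Finset.mem_union_left _ h₂, ?_,
      fun u hu => ?_⟩
    · rcases Finset.mem_union.1 hz with hz | hz
      · exact h₁ z hz
      · exact hw z (List.mem_toFinset.1 hz)
    · refine Finset.insert_subset (Finset.mem_union_right _ ?_)
        (h₃.trans Finset.subset_union_left)
      simp
    · rcases Finset.mem_union.1 hu with hu | hu
      · exact (h₄ u hu).mono (by simp)
      · rw [List.mem_toFinset] at hu
        refine .of_walk (w.takeUntil u hu) fun z hz => ?_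
        have := w.support_takeUntil_subset_support hu hz
        simp [this]

/-- A hub is a finite connected set meeting each given ray and adjacent to each vertex of `D`. -/
structure IsHub {V : Type u} (G : SimpleGraph V) (D : Finset V) {m : ℕ}
    (R : Fin m → GraphRay G) (C : Finset V) : Prop where
  nonempty : C.Nonempty
  disjoint : ∀ v ∈ D, v ∉ C
  reachIn : ∀ u ∈ C, ∀ v ∈ C, ReachIn G.Adj ↑C u v
  meets : ∀ i, ∃ n, (R i).f n ∈ C
  adj : ∀ v ∈ D, ∃ w ∈ C, G.Adj v w

lemma exists_isHub {V : Type u} {G : SimpleGraph V} {ω : GraphEnd G} {D : Finset V} {m : ℕ}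
    {R : Fin m → GraphRay G} (hD : ∀ v ∈ D, Dominates G v ω) (hR : ∀ i, R i ∈ ω.rays)
    (F : Finset V) : ∃ C, IsHub G D R C ∧ ∀ z ∈ C, z ∉ F := by
  classical
  obtain ⟨R₀, hR₀⟩ := ω.nonempty
  have hF : ((F ∪ D : Finset V) : Set V).Finite := Finset.finite_toSet _
  obtain ⟨M, hM⟩ := R₀.exists_forall_ge_notMem hF
  choose N hN using fun i => (R i).exists_forall_ge_notMem hF
  have hdom := fun v hv => (hD v hv).exists_adj_reachIn hF
    (by simp [hv]) hR₀ hM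
  choose! w hw hw' using hdom
  obtain ⟨C, h₁, h₂, h₃, h₄⟩ := exists_finset_connected G
    (F := ((F ∪ D : Finset V) : Set V)) (c := R₀.f M)
    (D.image w ∪ Finset.univ.image fun i => (R i).f (N i)) (hM M le_rfl) (by
      intro y hy
      simp only [Finset.mem_union, Finset.mem_image, Finset.mem_univ, true_and] at hy
      rcases hy with ⟨v, hv, rfl⟩ | ⟨i, rfl⟩
      · exact hw' v hv
      · exact GraphRay.exists_reachIn hR₀ (hR i) hF hM (hN i))
  refine ⟨C, ⟨h₂, fun v hv hvC => h₁ v hvC (by simp [hv]), h₄, fun i => ⟨N i, h₃ ?_⟩,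
    fun v hv => ⟨w v, h₃ ?_, hw v hv⟩⟩, fun z hz hzF => h₁ z hz (by simp [hzF])⟩
  · simp
  · exact Finset.mem_union_left _ (Finset.mem_image_of_mem w hv)

lemma exists_disjoint_hubs {V : Type u} {G : SimpleGraph V} {ω : GraphEnd G} {D : Finset V}
    {m : ℕ} {R : Fin m → GraphRay G} (hD : ∀ v ∈ D, Dominates G v ω)
    (hR : ∀ i, R i ∈ ω.rays) : ∃ H : ℕ → Finset V, (∀ j, IsHub G D R (H j)) ∧
      ∀ i j z, z ∈ H i → z ∈ H j → i = j := by
  classical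
  have : Std.Symm (fun C C' : Finset V => Disjoint C C') := ⟨fun _ _ h => h.symm⟩
  obtain ⟨H, h₁, h₂⟩ := exists_seq_of_forall_finset_exists' (IsHub G D R)
    (fun C C' => Disjoint C C') fun s _ => by
      obtain ⟨C, hC, hCs⟩ := exists_isHub hD hR (s.biUnion id)
      exact ⟨C, hC, fun C' hC' => Finset.disjoint_right.2 fun z hz hz' =>
        hCs z hz (Finset.mem_biUnion.2 ⟨C', hC', hz'⟩)⟩
  refine ⟨H, h₁, fun i j z hi hj => ?_⟩
  by_contra hij
  exact Finset.disjoint_left.1 (h₂ hij) hi hj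

/-- for `k ≤ deg(ω) + dom(ω)` there are `k` vertices, each a
start-vertex of one of a family of disjoint `ω`-rays or a dominating vertex off
those rays, which are highly linked by paths avoiding the rays. -/
theorem linked_starting_vertices {V : Type u} (G : SimpleGraph V) (ω : GraphEnd G)
    (k : ℕ) (hk : DegDomGE G ω k) :
    ∃ X : Finset V, X.card = k ∧
    ∃ ℛ : Set (GraphRay G), (∀ r ∈ ℛ, r ∈ ω.rays) ∧
      (ℛ.Pairwise fun r r' => Disjoint (Set.range r.f) (Set.range r'.f)) ∧
      (∀ x ∈ X, (∃ r ∈ ℛ, r.f 0 = x) ∨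
        (Dominates G x ω ∧ ∀ r ∈ ℛ, x ∉ Set.range r.f)) ∧
      ∀ A B : Finset V, A ⊆ X → B ⊆ X →
        ∃ (a b : Fin (min A.card B.card) → V) (p : ∀ i, G.Walk (a i) (b i)),
          (∀ i, a i ∈ A) ∧ (∀ i, b i ∈ B) ∧ (∀ i, (p i).IsPath) ∧
          (∀ i j, i ≠ j → ∀ x, x ∈ (p i).support → x ∉ (p j).support) ∧
          ∀ i, ∀ x ∈ (p i).support, x ≠ a i → x ≠ b i →
            x ∉ X ∧ ∀ r ∈ ℛ, x ∉ Set.range r.f := by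
  classical
  obtain ⟨m, n, rfl, ⟨R', hR', hdisj'⟩, D, rfl, hD⟩ := hk
  choose N hN using fun i => (R' i).exists_forall_ge_notMem D.finite_toSet
  obtain ⟨R, hR, hdisj, hRD⟩ : ∃ R : Fin m → GraphRay G, (∀ i, R i ∈ ω.rays) ∧
      (∀ i j a b, (R i).f a = (R j).f b → i = j) ∧ ∀ i n, (R i).f n ∉ D := by
    refine ⟨fun i => (R' i).drop_s13 (N i), fun i => GraphRay.drop_mem (hR' i) _,
      fun i j a b hab => ?_, fun i n => hN i _ (Nat.le_add_right _ _)⟩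
    by_contra hij
    exact disjoint_left.1 (hdisj' i j hij) ⟨_, rfl⟩ ⟨_, hab.symm⟩
  obtain ⟨H, hH, hHdisj⟩ := exists_disjoint_hubs hD hR
  obtain ⟨t, ht⟩ : ∃ t, ∀ i, ∀ j < m + D.card, ∀ n ≥ t, (R i).f n ∉ H j := by
    choose T hT using fun i => (R i).exists_forall_ge_notMem
      ((Finset.range (m + D.card)).biUnion H).finite_toSet
    refine ⟨Finset.univ.sup T, fun i j hj n hn hmem => hT i n
      ((Finset.le_sup (Finset.mem_univ i)).trans hn) ?_⟩
    exact Finset.mem_biUnion.2 ⟨j, Finset.mem_range.2 hj, hmem⟩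
  set X : Finset V := (Finset.univ.image fun i => (R i).f t) ∪ D with hXdef
  have hX : ∀ x, x ∈ X ↔ (∃ i, (R i).f t = x) ∨ x ∈ D := fun x => by simp [X]
  have hXc : X.card = m + D.card := by
    rw [hXdef, Finset.card_union_of_disjoint, Finset.card_image_of_injective]
    · simp
    · exact fun i j hij => hdisj i j t t hij
    · rw [Finset.disjoint_left]
      simp only [Finset.mem_image, Finset.mem_univ, true_and]
      rintro _ ⟨i, rfl⟩
      exact hRD i t
  set ℛ : Set (GraphRay G) := range fun i => (R i).drop_s13 t
  have hleg : ∀ x ∈ X, ∃ P : Finset V, x ∈ P ∧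
      (∀ z ∈ P, (z = x ∧ x ∈ D) ∨ ∃ i, (R i).f t = x ∧ ∃ l ≤ t, (R i).f l = z) ∧
      ∀ j < X.card, ∀ h ∈ H j, ReachIn G.Adj (↑P ∪ ↑(H j)) x h := by
    intro x hx
    rcases (hX x).1 hx with ⟨i, rfl⟩ | hxD
    · refine ⟨(Finset.range (t + 1)).image (R i).f,
        Finset.mem_image_of_mem _ (by simp), fun z hz => ?_, fun j hj h hh => ?_⟩
      · obtain ⟨l, hl, rfl⟩ := Finset.mem_image.1 hz
        exact .inr ⟨i, rfl, l, Nat.lt_succ_iff.1 (Finset.mem_range.1 hl), rfl⟩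
      · obtain ⟨l, hl⟩ := (hH j).meets i
        have hlt : l ≤ t := by
          by_contra! hlt
          exact ht i j (hXc ▸ hj) l hlt.le hl
        refine (((R i).reachIn hlt fun l' _ hl' => ?_).symm fun _ _ h => h.symm).trans
          (((hH j).reachIn _ hl h hh).mono subset_union_right)
        exact .inl (Finset.mem_image_of_mem _ (Finset.mem_range.2 (by omega)))
    · refine ⟨{x}, by simp, fun z hz => .inl ⟨by simpa using hz, hxD⟩, fun j hj h hh => ?_⟩
      obtain ⟨w, hw, hxw⟩ := (hH j).adj x hxD
      exact ((ReachIn.refl (by simp)).tail hxw (.inr hw)).trans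
        (((hH j).reachIn w hw h hh).mono subset_union_right)
  choose! P hxP hP hreach using hleg
  refine ⟨X, hXc, ℛ, ?_, ?_, fun x hx => ?_, fun A B hA hB => ?_⟩
  · rintro _ ⟨i, rfl⟩
    exact GraphRay.drop_mem (hR i) t
  · rintro _ ⟨i, rfl⟩ _ ⟨j, rfl⟩ hne
    rw [disjoint_left]
    rintro _ ⟨a, rfl⟩ ⟨b, hb⟩
    exact hne (by rw [hdisj j i _ _ hb])
  · rcases (hX x).1 hx with ⟨i, rfl⟩ | hxD
    · exact .inl ⟨_, ⟨i, rfl⟩, rfl⟩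
    · refine .inr ⟨hD x hxD, ?_⟩
      rintro _ ⟨i, rfl⟩ ⟨a, ha⟩
      exact hRD i (t + a) (by rw [show (R i).f (t + a) = x from ha]; exact hxD)
  · have hZ : ∀ i l, (R i).f l ∈ (X : Set V) ∪ ⋃ r ∈ ℛ, range r.f → t ≤ l := by
      rintro i l (hl | hl)
      · rcases (hX _).1 hl with ⟨i', hi'⟩ | hl
        · obtain rfl := hdisj _ _ _ _ hi'
          exact ((R i').inj hi').le
        · exact (hRD i l hl).elim
      · simp only [mem_iUnion] at hl
        obtain ⟨_, ⟨i', rfl⟩, a, ha⟩ := hl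
        have ha : (R i').f (t + a) = (R i).f l := ha
        obtain rfl := hdisj _ _ _ _ ha
        have := (R i').inj ha
        omega
    have hPdisj : ∀ x ∈ X, ∀ y ∈ X, ∀ z, z ∈ P x → z ∈ P y → x = y := by
      intro x hx y hy z hzx hzy
      rcases hP x hx z hzx with ⟨rfl, hxD⟩ | ⟨i, rfl, l, -, rfl⟩ <;>
        rcases hP y hy _ hzy with ⟨hz, hyD⟩ | ⟨i', rfl, l', -, hz⟩
      · exact hz
      · exact (hRD i' l' (hz ▸ hxD)).elim
      · exact (hRD i l (hz ▸ hyD)).elim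
      · rw [hdisj _ _ _ _ hz]
    have hPZ : ∀ x ∈ X, ∀ z ∈ P x, z ≠ x → z ∉ (X : Set V) ∪ ⋃ r ∈ ℛ, range r.f := by
      intro x hx z hz hne hzZ
      rcases hP x hx z hz with ⟨rfl, -⟩ | ⟨i, rfl, l, hl, rfl⟩
      · exact hne rfl
      · exact hne (by rw [le_antisymm hl (hZ i l hzZ)])
    have hHZ : ∀ j < X.card, ∀ z ∈ H j, z ∉ (X : Set V) ∪ ⋃ r ∈ ℛ, range r.f := by
      intro j hj z hz hzZ
      by_cases hzD : z ∈ D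
      · exact (hH j).disjoint z hzD hz
      · obtain ⟨i, l, rfl⟩ : ∃ i l, (R i).f l = z := by
          rcases hzZ with hzX | hzr
          · exact ((hX z).1 hzX).elim (fun ⟨i, hi⟩ => ⟨i, t, hi⟩) fun h => (hzD h).elim
          · simp only [mem_iUnion] at hzr
            obtain ⟨_, ⟨i, rfl⟩, a, ha⟩ := hzr
            exact ⟨i, t + a, ha⟩
        exact ht i j (hXc ▸ hj) l (hZ i l hzZ) hz
    obtain ⟨a, b, p, ha, hb, hp, hpd, hpZ⟩ := linked_of_hubs G X P H _ hPdisj hHdisj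
      (fun j => (hH j).nonempty) hxP hreach hPZ hHZ A B hA hB
    refine ⟨a, b, p, ha, hb, hp, hpd, fun i x hx hxa hxb => ?_⟩
    have := hpZ i x hx hxa hxb
    exact ⟨fun hxX => this (.inl hxX), fun r hr hxr => this (.inr (mem_biUnion hr hxr))⟩
end
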